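/- Let T be a tournament on n ≥ 6 vertices and let L be an integer with 3 ≤ L ≤ n − 3. If T is strongly 2-connected and T is not isomorphic to the unique tournament on 7 vertices that contains no transitive subtournament on 4 vertices, then T contains two vertex-disjoint directed cycles of lengths L and n − L. -/

import Mathlib

/-!
Common definitions: tournaments as irreflexive, asymmetric, total relations on a
finite vertex type; reachability/strong connectivity inside induced subtournaments;
directed paths and cycles as lists of vertices; linkedness; transitivity; domination.
All logarithms are base 2 (`Real.logb 2`).
-/

variable {V : Type*}

/-- `adj` is (the edge relation of) a tournament on `V`. -/
def IsTournament (adj : V → V → Prop) : Prop :=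
  (∀ v, ¬ adj v v) ∧ (∀ u v, adj u v → ¬ adj v u) ∧ (∀ u v, u ≠ v → adj u v ∨ adj v u)

/-- There is a directed path (possibly trivial) from `x` to `y` inside the induced
subtournament on `U`. -/
def ReachIn (adj : V → V → Prop) (U : Set V) (x y : V) : Prop :=
  Relation.ReflTransGen (fun a b => a ∈ U ∧ b ∈ U ∧ adj a b) x y

/-- The induced subtournament on `U` is strongly connected. -/
def StrConnOn (adj : V → V → Prop) (U : Set V) : Prop :=
  ∀ x ∈ U, ∀ y ∈ U, ReachIn adj U x y

/-- The induced subtournament on `U` is strongly `k`-connected: it has more than `k`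
vertices and removing any fewer than `k` vertices leaves it strongly connected. -/
def StrKConnOn (adj : V → V → Prop) (k : ℕ) (U : Set V) : Prop :=
  k < U.ncard ∧ ∀ S : Set V, S ⊆ U → S.ncard < k → StrConnOn adj (U \ S)

/-- The tournament is strongly `r`-connected for a real parameter `r`:
it has more than `r` vertices, and removal of any set of fewer than `r` vertices
leaves a strongly connected tournament. -/
def StrConnR [Fintype V] (adj : V → V → Prop) (r : ℝ) : Prop :=
  r < (Fintype.card V : ℝ) ∧ ∀ S : Set V, (S.ncard : ℝ) < r → StrConnOn adj (Set.univ \ S)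

/-- A directed path, recorded as its (nonempty, duplicate-free) list of vertices,
consecutive ones joined by edges. -/
def IsPathList (adj : V → V → Prop) (p : List V) : Prop :=
  p ≠ [] ∧ p.Nodup ∧ p.Chain' adj

/-- `p` is a directed path from `x` to `y`. -/
def PathFromTo (adj : V → V → Prop) (p : List V) (x y : V) : Prop :=
  IsPathList adj p ∧ p.head? = some x ∧ p.getLast? = some y

/-- The interior (internal vertices) of a path given as a list. -/
def Interior (p : List V) : List V := p.tail.dropLast

/-- A directed cycle, recorded as a duplicate-free list of at least 3 vertices,
consecutive ones joined by edges, and an edge from the last vertex back to the first. -/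
def IsCycleList (adj : V → V → Prop) (p : List V) : Prop :=
  3 ≤ p.length ∧ p.Nodup ∧ p.Chain' adj ∧ ∀ h : p ≠ [], adj (p.getLast h) (p.head h)

/-- A tournament is `k`-linked if it has at least `2k` vertices and any `2k` distinct
vertices `x₁,…,x_k,y₁,…,y_k` can be joined by vertex-disjoint directed paths
`Pᵢ : xᵢ → yᵢ`. -/
def KLinked [Fintype V] (adj : V → V → Prop) (k : ℕ) : Prop :=
  2 * k ≤ Fintype.card V ∧
    ∀ x y : Fin k → V, Function.Injective (Sum.elim x y) →
      ∃ P : Fin k → List V,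
        (∀ i, PathFromTo adj (P i) (x i) (y i)) ∧
        ∀ i j, i ≠ j → ∀ v ∈ P i, v ∉ P j

/-- The list `l` enumerates a transitive tournament: `l[i] → l[j]` iff `i < j`. -/
def TransList (adj : V → V → Prop) (l : List V) : Prop :=
  ∀ i j : Fin l.length, adj (l.get i) (l.get j) ↔ (i : ℕ) < (j : ℕ)

/-- The induced subtournament on `A` is transitive. -/
def IsTransSet (adj : V → V → Prop) (A : Set V) : Prop :=
  ∃ l : List V, l.Nodup ∧ (∀ x, x ∈ l ↔ x ∈ A) ∧ TransList adj l

/-- The induced subtournament on `A` is transitive with sink `v`. -/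
def IsTransSetSink (adj : V → V → Prop) (A : Set V) (v : V) : Prop :=
  ∃ l : List V, l.Nodup ∧ (∀ x, x ∈ l ↔ x ∈ A) ∧ TransList adj l ∧ l.getLast? = some v

/-- The induced subtournament on `A` is transitive with source `v`. -/
def IsTransSetSource (adj : V → V → Prop) (A : Set V) (v : V) : Prop :=
  ∃ l : List V, l.Nodup ∧ (∀ x, x ∈ l ↔ x ∈ A) ∧ TransList adj l ∧ l.head? = some v

/-- `A` out-dominates `B`: every `b ∈ B` receives an edge from some `a ∈ A`. -/
def OutDominates (adj : V → V → Prop) (A B : Set V) : Prop := ∀ b ∈ B, ∃ a ∈ A, adj a b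

/-- `A` in-dominates `B`: every `b ∈ B` sends an edge to some `a ∈ A`. -/
def InDominates (adj : V → V → Prop) (A B : Set V) : Prop := ∀ b ∈ B, ∃ a ∈ A, adj b a

/-- The list `l` enumerates a backwards-transitive path:
`l[i] → l[j]` iff `j = i + 1` or `i ≥ j + 2`. -/
def BackTransList (adj : V → V → Prop) (l : List V) : Prop :=
  ∀ i j : Fin l.length,
    adj (l.get i) (l.get j) ↔ ((j : ℕ) = (i : ℕ) + 1 ∨ (j : ℕ) + 2 ≤ (i : ℕ))

/-- The induced subtournament on `Q` is a backwards-transitive path. -/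
def IsBackTransPathSet (adj : V → V → Prop) (Q : Set V) : Prop :=
  ∃ l : List V, l ≠ [] ∧ l.Nodup ∧ (∀ x, x ∈ l ↔ x ∈ Q) ∧ BackTransList adj l

/-- The ordered pair `(x, y)` is `k`-connected in the induced subtournament on `U`:
after deleting any fewer than `k` vertices of `U` other than `x, y`,
there still is a directed path from `x` to `y`. -/
def KConnPair (adj : V → V → Prop) (U : Set V) (k : ℕ) (x y : V) : Prop :=
  ∀ S : Set V, S ⊆ U \ {x, y} → S.ncard < k → ReachIn adj (U \ S) x y

section
namespace TT
open Classical Finset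

def Str (adj : V → V → Prop) (B : Finset V) : Prop :=
  ∀ U ⊆ B, U.Nonempty → U ≠ B → ∃ u ∈ U, ∃ w ∈ B, w ∉ U ∧ adj u w

variable {adj : V → V → Prop}

theorem flipT (hT : IsTournament adj) : IsTournament (flip adj) := by
  obtain ⟨h1, h2, h3⟩ := hT
  refine ⟨h1, fun u v h => h2 _ _ h, fun u v h => h3 _ _ h.symm⟩

theorem Str.flip {B : Finset V} (h : Str adj B) : Str (flip adj) B := by
  intro U hU hne hneq
  obtain ⟨u, hu, w, hw, hwU, ha⟩ := h (B \ U) sdiff_subset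
    (by rw [sdiff_nonempty]; intro h; exact hneq (Subset.antisymm hU h))
    (by
      obtain ⟨x, hx⟩ := hne
      intro h
      have := hU hx
      rw [← h] at this
      simp_all)
  simp only [mem_sdiff, not_and, not_not] at hu hwU
  exact ⟨w, hwU hw, u, hu.1, hu.2, ha⟩

theorem Str.ineg {B : Finset V} (h : Str adj B) :
    ∀ U ⊆ B, U.Nonempty → U ≠ B → ∃ u ∈ U, ∃ w ∈ B, w ∉ U ∧ adj w u := h.flip

theorem Str.unflip {B : Finset V} (h : Str (_root_.flip adj) B) : Str adj B := h.flip

theorem str_root {A : Finset V} (r : V)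
    (h1 : ∀ U ⊆ A, U.Nonempty → r ∉ U → ∃ u ∈ U, ∃ w ∈ A, w ∉ U ∧ adj u w)
    (h2 : ∀ U ⊆ A, U.Nonempty → r ∉ U → ∃ u ∈ U, ∃ w ∈ A, w ∉ U ∧ adj w u) :
    Str adj A := by
  intro U hU hne hneq
  by_cases hrU : r ∈ U
  · obtain ⟨u, hu, w, hw, hwU, ha⟩ := h2 (A \ U) sdiff_subset
      (by rw [sdiff_nonempty]; intro h; exact hneq (Subset.antisymm hU h)) (by simp [hrU])
    simp only [mem_sdiff, not_and, not_not] at hu hwU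
    exact ⟨w, hwU hw, u, hu.1, hu.2, ha⟩
  · exact h1 U hU hne hrU

/-- restricted cut: if `U` meets `B` properly -/
theorem Str.cut {B : Finset V} (h : Str adj B) (U : Finset V) {a b : V} (ha : a ∈ B) (haU : a ∈ U)
    (hb : b ∈ B) (hbU : b ∉ U) : ∃ u ∈ B, u ∈ U ∧ ∃ w ∈ B, w ∉ U ∧ adj u w := by
  obtain ⟨u, hu, w, hw, hwU, hadj⟩ := h (U ∩ B) inter_subset_right ⟨a, by simp [*]⟩
    (by intro h; rw [← h] at hb; exact hbU (mem_inter.1 hb).1)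
  simp only [mem_inter, not_and] at hu hwU
  exact ⟨u, hu.2, hu.1, w, hw, fun h => hwU h hw, hadj⟩

/-- From a cut that all sets meeting `B` properly are left. -/
theorem str_of_cut {B : Finset V} (h : ∀ U : Finset V, ∀ a ∈ B, a ∈ U → ∀ b ∈ B, b ∉ U →
    ∃ u ∈ B, u ∈ U ∧ ∃ w ∈ B, w ∉ U ∧ adj u w) : Str adj B := by
  intro U hU hne hneq
  obtain ⟨a, ha⟩ := hne
  have : ∃ b ∈ B, b ∉ U := by
    by_contra hc
    push Not at hc
    exact hneq (Subset.antisymm hU hc)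
  obtain ⟨b, hb, hbU⟩ := this
  obtain ⟨u, _, hu, w, hw, hwU, hadj⟩ := h U a (hU ha) ha b hb hbU
  exact ⟨u, hu, w, hw, hwU, hadj⟩

theorem str_singleton (v : V) : Str adj {v} := by
  intro U hU hne hneq
  rcases subset_singleton_iff.1 hU with h | h
  · simp [h] at hne
  · exact absurd h hneq

theorem str_insert {B : Finset V} (h : Str adj B) {v a b : V} (ha : a ∈ B) (hb : b ∈ B)
    (hva : adj v a) (hbv : adj b v) : Str adj (insert v B) := by
  refine str_of_cut fun U p hp hpU q hq hqU => ?_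
  by_cases hc : (∃ p ∈ B, p ∈ U) ∧ (∃ q ∈ B, q ∉ U)
  · obtain ⟨⟨p, hp, hpU⟩, ⟨q, hq, hqU⟩⟩ := hc
    obtain ⟨u, hu, hu', w, hw, hw', hh⟩ := h.cut U hp hpU hq hqU
    exact ⟨u, by simp [hu], hu', w, by simp [hw], hw', hh⟩
  · rw [not_and_or] at hc
    push Not at hc
    simp only [mem_insert] at hp hq ⊢
    rcases hc with hc | hc
    · have : p = v := by rcases hp with h | h
                         · exact h
                         · exact absurd hpU (hc p h)
      subst this
      exact ⟨p, .inl rfl, hpU, a, .inr ha, hc a ha, hva⟩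
    · have : q = v := by rcases hq with h | h
                         · exact h
                         · exact absurd (hc q h) hqU
      subst this
      exact ⟨b, .inr hb, hc b hb, q, .inl rfl, hqU, hbv⟩

/-- `p ⇒ B ⇒ m → p` -/
theorem str_cyc {B : Finset V} (hB : B.Nonempty) {p m : V} (h1 : ∀ b ∈ B, adj p b)
    (h2 : ∀ b ∈ B, adj b m) (h3 : adj m p) : Str adj (insert m (insert p B)) := by
  obtain ⟨b, hb⟩ := hB
  refine str_of_cut fun U s hs hsU q hq hqU => ?_
  simp only [mem_insert] at hs hq ⊢
  by_cases hm : m ∈ U <;> by_cases hp : p ∈ U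
  · have : q ∈ B := by grind
    exact ⟨p, by simp, hp, q, by simp [this], hqU, h1 q this⟩
  · exact ⟨m, by simp, hm, p, by simp, hp, h3⟩
  · by_cases hbU : b ∈ U
    · exact ⟨b, by simp [hb], hbU, m, by simp, hm, h2 b hb⟩
    · exact ⟨p, by simp, hp, b, by simp [hb], hbU, h1 b hb⟩
  · have : s ∈ B := by grind
    exact ⟨s, by simp [this], hsU, m, by simp, hm, h2 s this⟩

theorem str_tri {a b c : V} (h1 : adj a b) (h2 : adj b c) (h3 : adj c a) :
    Str adj {a, b, c} := by
  have := str_cyc (adj := adj) (B := {b}) (p := a) (m := c) (by simp) (by simpa) (by simpa) h3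
  convert this using 1
  grind

/-- every vertex of a strong set has an out-neighbour -/
theorem Str.out {B : Finset V} (h : Str adj B) {v : V} (hv : v ∈ B) (hc : 2 ≤ B.card) :
    ∃ w ∈ B, adj v w := by
  obtain ⟨u, hu, w, hw, hwU, ha⟩ := h {v} (by simpa) (by simp) (by rintro rfl; simp at hc)
  simp at hu; subst hu; exact ⟨w, hw, ha⟩

theorem Str.inn {B : Finset V} (h : Str adj B) {v : V} (hv : v ∈ B) (hc : 2 ≤ B.card) :
    ∃ w ∈ B, adj w v := h.flip.out hv hc

theorem str_triangle_through (hT : IsTournament adj) {B : Finset V} (h : Str adj B)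
    {v : V} (hv : v ∈ B) (hc : 2 ≤ B.card) :
    ∃ a ∈ B, ∃ b ∈ B, adj v a ∧ adj a b ∧ adj b v := by
  obtain ⟨h1, h2, h3⟩ := hT
  obtain ⟨w, hw, hvw⟩ := h.out hv hc
  obtain ⟨w', hw', hvw'⟩ := h.inn hv hc
  obtain ⟨a, ha, ha', b, hb, hb', hab⟩ := h.cut (B.filter (fun a => adj v a)) hw (by simp [*])
    hv (by simp [h1])
  simp only [mem_filter, not_and] at ha' hb'
  have := hb' hb
  have hbv : b ≠ v := by rintro rfl; exact h2 _ _ ha'.2 hab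
  exact ⟨a, ha, b, hb, ha'.2, hab, (h3 _ _ hbv).resolve_right (hb' hb)⟩

/-- the basic extension step -/
theorem ext_core (hT : IsTournament adj) {Z B : Finset V} (hZ : Str adj Z)
    (hBZ : B ⊆ Z) (hne : B.Nonempty) (hneq : B ≠ Z) :
    (∃ v ∈ Z, v ∉ B ∧ (∃ a ∈ B, adj v a) ∧ (∃ b ∈ B, adj b v)) ∨
    (∃ m ∈ Z, ∃ p ∈ Z, m ∉ B ∧ p ∉ B ∧ adj m p ∧ (∀ b ∈ B, adj p b) ∧ (∀ b ∈ B, adj b m)) := by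
  by_cases hmix : ∃ v ∈ Z, v ∉ B ∧ (∃ a ∈ B, adj v a) ∧ (∃ b ∈ B, adj b v)
  · exact .inl hmix
  right
  push Not at hmix
  obtain ⟨h1, h2, h3⟩ := hT
  obtain ⟨b0, hb0⟩ := hne
  obtain ⟨c, hc, hcB⟩ : ∃ c ∈ Z, c ∉ B := by
    by_contra hc; push Not at hc; exact hneq (Subset.antisymm hBZ hc)
  obtain ⟨u, hu, m, hm, hmB, hum⟩ := hZ B hBZ ⟨b0, hb0⟩ hneq
  -- the set B together with dominated vertices
  have dom : ∀ m ∈ Z, m ∉ B → (∃ u ∈ B, adj u m) → ∀ b ∈ B, adj b m := by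
    intro m hm hmB hu b hb
    by_contra hcon
    have : adj m b := (h3 m b (by rintro rfl; exact hmB hb)).resolve_right hcon
    obtain ⟨u, hu, hum⟩ := hu
    exact hmix m hm hmB ⟨b, hb, this⟩ u hu hum
  obtain ⟨u', hu', hu'', p, hp, hpU, hup⟩ :
     ∃ u ∈ Z, u ∈ B ∪ Z.filter (fun m => ∃ u ∈ B, adj u m) ∧ ∃ p ∈ Z, p ∉ B ∪ Z.filter (fun m => ∃ u ∈ B, adj u m) ∧ adj u p := by
    obtain ⟨q, hq, q', hq', hqB, hqq⟩ := hZ.ineg B hBZ ⟨b0, hb0⟩ hneq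
    refine hZ.cut (B ∪ Z.filter (fun m => ∃ u ∈ B, adj u m)) hm (by simp; right; exact ⟨hm, u, hu, hum⟩) hq' ?_
    simp only [mem_union, mem_filter, not_or, not_and, not_exists]
    exact ⟨hqB, fun _ => hmix q' hq' hqB ⟨q, hq, hqq⟩⟩
  simp only [mem_union, mem_filter, not_or, not_and, not_exists] at hu'' hpU
  have hpd : ∀ b ∈ B, adj p b := fun b hb =>
    (h3 p b (by rintro rfl; exact hpU.1 hb)).resolve_right (hpU.2 hp b hb)
  rcases hu'' with h | h
  · exact absurd hup (hpU.2 hp u' h)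
  · obtain ⟨hz, w, hw, hwu⟩ := h
    have huB : u' ∉ B := by
      intro h
      exact hpU.2 hp u' h hup
    exact ⟨u', hu', p, hp, huB, hpU.1, hup, hpd, dom u' hu' huB ⟨w, hw, hwu⟩⟩

theorem ext_step (hT : IsTournament adj) {Z B : Finset V} (hZ : Str adj Z) (hB : Str adj B)
    (hBZ : B ⊆ Z) (hne : B.Nonempty) (hneq : B ≠ Z) :
    (∃ v ∈ Z, v ∉ B ∧ Str adj (insert v B)) ∨
    (∃ m ∈ Z, ∃ p ∈ Z, m ∉ B ∧ p ∉ B ∧ adj m p ∧ (∀ b ∈ B, adj p b) ∧ (∀ b ∈ B, adj b m)) := by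
  rcases ext_core hT hZ hBZ hne hneq with h | h
  · obtain ⟨v, hv, hvB, ⟨a, ha, hva⟩, b, hb, hbv⟩ := h
    exact .inl ⟨v, hv, hvB, str_insert hB ha hb hva hbv⟩
  · exact .inr h

/-- Grow, keeping a set K with fewer elements than B. -/
theorem grow_step (hT : IsTournament adj) {Z B K : Finset V} (hZ : Str adj Z) (hB : Str adj B)
    (hBZ : B ⊆ Z) (hKB : K ⊆ B) (hK : K.card < B.card) (h2 : 2 ≤ B.card) (hneq : B ≠ Z) :
    ∃ B' ⊆ Z, Str adj B' ∧ K ⊆ B' ∧ B'.card = B.card + 1 := by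
  have hne : B.Nonempty := by rw [← card_pos]; omega
  rcases ext_step hT hZ hB hBZ hne hneq with ⟨v, hv, hvB, h⟩ | ⟨m, hm, p, hp, hmB, hpB, hmp, h1, h2'⟩
  · exact ⟨insert v B, by grind, h, by grind, by simp [hvB]⟩
  · obtain ⟨c, hc, hcK⟩ := exists_mem_notMem_of_card_lt_card hK
    have hmp' : m ≠ p := by rintro rfl; exact hT.1 _ hmp
    refine ⟨insert m (insert p (B.erase c)), by grind, ?_, by grind, ?_⟩
    · refine str_cyc ?_ (by grind) (by grind) hmp
      rw [← card_pos, card_erase_of_mem hc]; omega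
    · rw [card_insert_of_notMem (by grind), card_insert_of_notMem (by grind), card_erase_of_mem hc]
      omega

theorem grow_keep (hT : IsTournament adj) {Z B K : Finset V} (hZ : Str adj Z) (hB : Str adj B)
    (hBZ : B ⊆ Z) (hKB : K ⊆ B) (hK : K.card < B.card) (h2 : 2 ≤ B.card) (m : ℕ)
    (hm : B.card ≤ m) (hmZ : m ≤ Z.card) :
    ∃ B' ⊆ Z, Str adj B' ∧ K ⊆ B' ∧ B'.card = m := by
  induction m, hm using Nat.le_induction with
  | base => exact ⟨B, hBZ, hB, hKB, rfl⟩
  | succ m hm ih =>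
    obtain ⟨B', h1, h2', h3, h4⟩ := ih (by omega)
    obtain ⟨B'', g1, g2, g3, g4⟩ := grow_step hT hZ h2' h1 h3 (by omega) (by omega)
      (by rintro rfl; omega)
    exact ⟨B'', g1, g2, g3, by omega⟩

theorem grow (hT : IsTournament adj) {Z : Finset V} (hZ : Str adj Z) {b : V} (hb : b ∈ Z) (m : ℕ)
    (hm : 3 ≤ m) (hmZ : m ≤ Z.card) : ∃ B ⊆ Z, Str adj B ∧ b ∈ B ∧ B.card = m := by
  obtain ⟨u, hu, w, hw, h1, h2, h3⟩ := str_triangle_through hT hZ hb (by omega)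
  have hc : ({b, u, w} : Finset V).card = 3 := by
    rw [card_eq_three]
    refine ⟨b, u, w, ?_, ?_, ?_, rfl⟩
    · rintro rfl; exact hT.1 _ h1
    · rintro rfl; exact hT.1 _ h3
    · rintro rfl; exact hT.1 _ h2
  obtain ⟨B, g1, g2, g3, g4⟩ := grow_keep hT hZ (str_tri h1 h2 h3) (K := {b}) (by grind) (by simp)
    (by simp [hc]) (by omega) m (by omega) hmZ
  exact ⟨B, g1, g2, by simpa using g3, g4⟩

end TT
end

section
namespace TT
open Classical Finset
variable {adj : V → V → Prop}

def Cy (adj : V → V → Prop) (p : List V) : Prop :=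
  p.Nodup ∧ p.IsChain adj ∧ ∀ x ∈ p.getLast?, ∀ y ∈ p.head?, adj x y

theorem Cy.rot {l1 l2 : List V} (h : Cy adj (l1 ++ l2)) : Cy adj (l2 ++ l1) := by
  obtain ⟨h1, h2, h3⟩ := h
  refine ⟨List.nodup_append_comm.1 h1, ?_, ?_⟩
  · rw [List.isChain_append] at h2 ⊢
    refine ⟨h2.2.1, h2.1, ?_⟩
    intro x hx y hy
    refine h3 x ?_ y ?_
    · rw [List.getLast?_append]; simp at hx ⊢; simp [hx]
    · rw [List.head?_append]; simp at hy ⊢; simp [hy]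
  · rw [List.isChain_append] at h2
    rcases l1 with _ | ⟨a, l1⟩
    · simpa using h3
    rcases l2 with _ | ⟨b, l2⟩
    · simpa using h3
    intro x hx y hy
    apply h2.2.2
    · rw [List.getLast?_append] at hx
      simp at hx ⊢
      simpa [List.getLast?_cons] using hx
    · simpa using hy

theorem find_split (P : V → Prop) : ∀ (l : List V) (x : V), P x → (∃ y ∈ l, ¬ P y) →
    ∃ l1 c d l2, x :: l = l1 ++ c :: d :: l2 ∧ P c ∧ ¬ P d
  | [], _, _, h => by simp at h
  | y :: l, x, hx, h => by
    by_cases hy : P y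
    · obtain ⟨l1, c, d, l2, h1, h2, h3⟩ := find_split P l y hy (by simpa [hy] using h)
      exact ⟨x :: l1, c, d, l2, by simp [h1], h2, h3⟩
    · exact ⟨[], x, y, l, rfl, hx, hy⟩

theorem cy_extend (hT : IsTournament adj) {Z : Finset V} (hZ : Str adj Z) {p : List V}
    (hp : Cy adj p) (hpZ : p.toFinset ⊆ Z) (hne : p ≠ []) (hneq : p.toFinset ≠ Z) :
    ∃ q, Cy adj q ∧ q.toFinset ⊆ Z ∧ p.length < q.length := by
  have key : ∀ q : List V, Cy adj q → q.toFinset ⊆ Z → p.length < q.length → 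
    ∃ q, Cy adj q ∧ q.toFinset ⊆ Z ∧ p.length < q.length := fun q a b c => ⟨q, a, b, c⟩
  rcases ext_core hT hZ hpZ (by simpa) hneq with ⟨v, hv, hvB, ⟨a, ha, hva⟩, b, hb, hbv⟩ | ⟨m, hm, q, hq, hmB, hqB, hmp, h1, h2'⟩
  · simp only [List.mem_toFinset] at ha hb hvB
    -- rotate so that b is first
    obtain ⟨s, t, hst⟩ := List.append_of_mem hb
    have hr : Cy adj (b :: t ++ s) := by rw [hst] at hp; exact hp.rot
    have hmem : ∀ z, z ∈ b :: (t ++ s) ↔ z ∈ p := by intro z; rw [hst]; simp; tauto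
    have hlen : (b :: (t ++ s)).length = p.length := by rw [hst]; simp; omega
    have hab : a ≠ b := by rintro rfl; exact hT.2.1 _ _ hva hbv
    have ha' : a ∈ t ++ s := by have := (hmem a).2 ha; simpa [hab] using this
    obtain ⟨l1, c, d, l2, e1, e2, e3⟩ := find_split (fun z => adj z v) (t ++ s) b hbv
      ⟨a, ha', hT.2.1 _ _ hva⟩
    have hr2 : Cy adj ((l1 ++ [c]) ++ (d :: l2)) := by
      have : l1 ++ [c] ++ d :: l2 = b :: t ++ s := by simp at e1 ⊢; exact e1.symm
      rw [this]; exact hr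
    have hr3 := hr2.rot
    have hmem2 : ∀ z, z ∈ d :: l2 ++ (l1 ++ [c]) ↔ z ∈ p := by
      intro z; rw [← hmem, e1]; simp; tauto
    have hvd : adj v d := by
      refine (hT.2.2 v d ?_).resolve_right e3
      rintro rfl; exact hvB ((hmem2 v).1 (by simp))
    refine key ((d :: l2 ++ (l1 ++ [c])) ++ [v]) ⟨?_, ?_, ?_⟩ ?_ ?_
    · rw [List.nodup_append]
      refine ⟨hr3.1, by simp, ?_⟩
      intro x hx y hy
      simp at hy; subst hy
      rintro rfl; exact hvB ((hmem2 _).1 hx)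
    · rw [List.isChain_append]
      refine ⟨hr3.2.1, by simp, ?_⟩
      intro x hx y hy
      rw [← List.append_assoc, List.getLast?_append] at hx
      simp at hx hy
      subst hx hy; exact e2
    · intro x hx y hy
      rw [List.getLast?_append] at hx
      simp at hx hy; subst hx hy; exact hvd
    · intro z hz
      rw [List.mem_toFinset, List.mem_append, hmem2] at hz
      rcases hz with h | h
      · exact hpZ (by simpa using h)
      · simp at h; subst h; exact hv
    · have := congrArg List.length e1
      rw [hlen] at this; rw [this]; simp; omega
  · simp only [List.mem_toFinset] at h1 h2' hmB hqB
    have hmq : m ≠ q := by rintro rfl; exact hT.1 _ hmp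
    refine key (p ++ [m, q]) ⟨?_, ?_, ?_⟩ ?_ ?_
    · rw [List.nodup_append]
      refine ⟨hp.1, by simp [hmq], ?_⟩
      intro x hx y hy
      rintro rfl
      simp at hy
      rcases hy with rfl | rfl <;> contradiction
    · rw [List.isChain_append]
      refine ⟨hp.2.1, by simp [hmp], ?_⟩
      intro x hx y hy
      simp at hy; subst hy
      exact h2' _ (List.mem_of_getLast? (by simpa using hx))
    · intro x hx y hy
      rw [List.getLast?_append] at hx
      rw [List.head?_append] at hy
      obtain ⟨e, l, rfl⟩ := List.exists_cons_of_ne_nil hne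
      simp at hx hy; subst hx hy; exact h1 _ (by simp)
    · intro z hz
      simp at hz
      rcases hz with h | h | h
      · subst h; exact hm
      · subst h; exact hq
      · exact hpZ (by simpa using h)
    · simp

theorem camion (hT : IsTournament adj) {Z : Finset V} (hZ : Str adj Z) (hc : 3 ≤ Z.card) :
    ∃ p : List V, IsCycleList adj p ∧ p.toFinset = Z := by
  have hne : Z.Nonempty := by rw [← card_pos]; omega
  obtain ⟨z, hz⟩ := hne
  have hle : ∀ p, Cy adj p → p.toFinset ⊆ Z → p.length ≤ Z.card := by
    intro p hp hpZ
    rw [← List.toFinset_card_of_nodup hp.1]; exact card_le_card hpZ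
  obtain ⟨a, ha, b, hb, h1, h2, h3⟩ := str_triangle_through hT hZ hz (by omega)
  have h0 : Cy adj [z, a, b] := by
    have i1 : z ≠ a := by rintro rfl; exact hT.1 _ h1
    have i2 : a ≠ b := by rintro rfl; exact hT.1 _ h2
    have i3 : z ≠ b := by rintro rfl; exact hT.1 _ h3
    refine ⟨by simp [*], by simp [*], by simp [*]⟩
  have main : ∀ d p, Cy adj p → p.toFinset ⊆ Z → 3 ≤ p.length → Z.card - p.length = d →
      ∃ p, Cy adj p ∧ p.toFinset = Z := by
    intro d
    induction d using Nat.strong_induction_on with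
    | _ d ih =>
      intro p hp hpZ h3 hd
      by_cases he : p.toFinset = Z
      · exact ⟨p, hp, he⟩
      obtain ⟨q, hq, hqZ, hlt⟩ := cy_extend hT hZ hp hpZ (by rintro rfl; simp at h3) he
      have := hle q hq hqZ
      exact ih (Z.card - q.length) (by omega) q hq hqZ (by omega) rfl
  obtain ⟨p, hp, hpZ⟩ := main _ [z, a, b] h0 (by intro x; simp; grind) (by simp) rfl
  refine ⟨p, ⟨?_, hp.1, hp.2.1, ?_⟩, hpZ⟩
  · rw [← List.toFinset_card_of_nodup hp.1, hpZ]; exact hc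
  · intro h
    exact hp.2.2 _ (by simp [List.getLast?_eq_getLast_of_ne_nil h]) _ (by simp [List.head?_eq_some_head h])

theorem str_of_conn {B : Finset V} (h : StrConnOn adj (B : Set V)) : Str adj B := by
  intro U hU ⟨u, hu⟩ hneq
  by_contra hcon
  push Not at hcon
  apply hneq
  refine Subset.antisymm hU fun w hw => ?_
  have := h u (by simpa using hU hu) w (by simpa using hw)
  unfold ReachIn at this
  induction this with
  | refl => exact hu
  | tail _ hbc ih =>
    obtain ⟨hb, hc, hadj⟩ := hbc
    by_contra hn
    exact hcon _ (ih (by simpa using hb)) _ hw hn hadj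

end TT
end

section
namespace TT
open Classical Finset
variable {adj : V → V → Prop}

theorem Str.closed {B : Finset V} (h : Str adj B) (U : Finset V)
    (hU : ∀ u ∈ U, u ∈ B → ∀ w ∈ B, adj u w → w ∈ U) {a b : V} (ha : a ∈ B) (haU : a ∈ U)
    (hb : b ∈ B) (hbU : b ∉ U) : False := by
  obtain ⟨u, h1, h2, w, h3, h4, h5⟩ := h.cut U ha haU hb hbU
  exact h4 (hU u h2 h1 w h3 h5)

/-- extraction of a closed set from non-strongness -/
theorem not_str {B : Finset V} (h : ¬ Str adj B) :
    ∃ U ⊆ B, U.Nonempty ∧ (∃ q ∈ B, q ∉ U) ∧ ∀ u ∈ U, ∀ w ∈ B, adj u w → w ∈ U := by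
  unfold Str at h
  push Not at h
  obtain ⟨U, h1, h2, h3, h4⟩ := h
  refine ⟨U, h1, h2, ?_, ?_⟩
  · by_contra hc; push Not at hc; exact h3 (Subset.antisymm h1 hc)
  · intro u hu w hw ha
    by_contra hc
    exact h4 u hu w hw hc ha

def Trap (adj : V → V → Prop) (B : Finset V) (c : V) (E : Finset V) : Prop :=
  c ∈ B ∧ E ⊆ B ∧ c ∉ E ∧ E.Nonempty ∧ (∃ q ∈ B, q ∉ E ∧ q ≠ c) ∧
    ∀ e ∈ E, ∀ w ∈ B, adj e w → w ∈ E ∨ w = c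

theorem trap_of_crit {B : Finset V} {c : V} (hc : c ∈ B) (h : ¬ Str adj (B.erase c)) :
    ∃ E, Trap adj B c E := by
  obtain ⟨U, h1, h2, ⟨q, hq, hqU⟩, h4⟩ := not_str h
  refine ⟨U, hc, h1.trans (erase_subset _ _), fun h => ?_, h2, ⟨q, by grind, hqU, by grind⟩, ?_⟩
  · simpa using h1 h
  · intro e he w hw ha
    by_cases hwc : w = c
    · exact .inr hwc
    · exact .inl (h4 e he w (by simp [hw, hwc]) ha)

theorem trap2 (hT : IsTournament adj) {B : Finset V} (hB : Str adj B) {c e : V} {E E' : Finset V}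
    (h1 : Trap adj B c E) (he : e ∈ E) (h2 : Trap adj B e E') : c ∉ E' := by
  obtain ⟨a1, a2, a3, a4, ⟨q, q1, q2, q3⟩, a6⟩ := h1
  obtain ⟨b1, b2, b3, b4, ⟨r, r1, r2, r3⟩, b6⟩ := h2
  obtain ⟨t1, t2, t3⟩ := hT
  intro hc
  by_cases hx : ∃ p ∈ E', p ∉ E ∧ p ≠ c
  · obtain ⟨p, p1, p2, p3⟩ := hx
    have hE : ∀ x ∈ E, x ∈ E' ∨ x = e := by
      intro x hx
      by_cases hxe : x = e
      · exact .inr hxe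
      refine b6 p p1 x (a2 hx) ?_
      refine (t3 p x (by rintro rfl; exact p2 hx)).resolve_right fun h => ?_
      rcases a6 x hx p (b2 p1) h with h | h <;> contradiction
    refine hB.closed (insert e E') ?_ b1 (by simp) r1 (by simp [r2, r3])
    intro u hu huB w hw ha
    simp only [mem_insert] at hu ⊢
    rcases hu with rfl | hu
    · rcases a6 u he w hw ha with h | h
      · exact (hE w h).symm
      · subst h; exact .inr hc
    · exact (b6 u hu w hw ha).symm
  · push Not at hx
    refine hB.closed (insert c E) ?_ a1 (by simp) q1 (by simp [q2, q3])
    intro u hu huB w hw ha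
    simp only [mem_insert] at hu ⊢
    rcases hu with rfl | hu
    · rcases b6 u hc w hw ha with h | h
      · by_cases hwE : w ∈ E
        · exact .inr hwE
        · exact .inl (hx w h hwE)
      · subst h; exact .inr he
    · exact (a6 u hu w hw ha).symm

theorem trap3 (hT : IsTournament adj) {B : Finset V} (hB : Str adj B) {c e : V} {E E' : Finset V}
    (h1 : Trap adj B c E) (he : e ∈ E) (h2 : Trap adj B e E') (hne : E ≠ {e}) :
    Trap adj B e (E ∩ E') := by
  have hcE := trap2 hT hB h1 he h2
  obtain ⟨a1, a2, a3, a4, ⟨q, q1, q2, q3⟩, a6⟩ := h1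
  obtain ⟨b1, b2, b3, b4, ⟨r, r1, r2, r3⟩, b6⟩ := h2
  obtain ⟨t1, t2, t3⟩ := hT
  have hce : c ≠ e := by rintro rfl; contradiction
  refine ⟨b1, by grind, by simp [b3], ?_, ⟨c, a1, by simp [a3], hce⟩, ?_⟩
  · by_cases hx : ∃ p ∈ E', p ∉ E
    · obtain ⟨p, p1, p2⟩ := hx
      obtain ⟨y, y1, y2⟩ : ∃ y ∈ E, y ≠ e := by
        by_contra hcon; push Not at hcon; exact hne (by ext z; simp; grind)
      have : adj p y := by
        refine (t3 p y (by rintro rfl; contradiction)).resolve_right fun h => ?_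
        rcases a6 y y1 p (b2 p1) h with h | h
        · contradiction
        · subst h; contradiction
      refine ⟨y, mem_inter.2 ⟨y1, (b6 p p1 y (a2 y1) this).resolve_right y2⟩⟩
    · push Not at hx
      obtain ⟨p, hp⟩ := b4
      exact ⟨p, by simp [hp, hx p hp]⟩
  · intro u hu w hw ha
    simp only [mem_inter] at hu ⊢
    have g1 := a6 u hu.1 w hw ha
    have g2 := b6 u hu.2 w hw ha
    rcases g2 with g2 | g2
    · rcases g1 with g1 | g1
      · exact .inl ⟨g1, g2⟩
      · subst g1; contradiction
    · exact .inr g2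

def Two (adj : V → V → Prop) (W : Finset V) : Prop :=
  Str adj W ∧ ∀ c ∈ W, Str adj (W.erase c)

theorem lemma_star (hT : IsTournament adj) {W B : Finset V} (hW : Two adj W) (hB : Str adj B)
    (hBW : B ⊆ W) (hneq : B ≠ W) (hc : 4 ≤ B.card) :
    ∃ b ∈ B, Str adj (B.erase b) ∧ ∃ a ∈ W, a ∉ B ∧ adj b a := by
  by_contra hcon
  have hcrit : ∀ b ∈ B, (∃ a ∈ W, a ∉ B ∧ adj b a) → ¬ Str adj (B.erase b) :=
    fun b hb h hs => hcon ⟨b, hb, hs, h⟩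
  have s1 : ∀ c E, Trap adj B c E → ∃ e ∈ E, ∃ E', Trap adj B e E' := by
    intro c E h
    obtain ⟨a1, a2, a3, ⟨a, a4⟩, ⟨q, q1, q2, q3⟩, a6⟩ := h
    obtain ⟨e, he, he', w, hw, hwE, ha⟩ := (hW.2 c (hBW a1)).cut E (a := a) (b := q)
      (by simp; refine ⟨?_, hBW (a2 a4)⟩; rintro rfl; contradiction) a4 (by simp [q3, hBW q1]) q2
    refine ⟨e, he', trap_of_crit (a2 he') (hcrit e (a2 he') ⟨w, by grind, ?_, ha⟩)⟩
    intro hwB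
    rcases a6 e he' w hwB ha with h | h
    · contradiction
    · simp [h] at hw
  have s4 : ∀ c e f, Trap adj B c {e} → Trap adj B e {f} → False := by
    intro c e f h1 h2
    obtain ⟨f', hf, E, h3⟩ := s1 _ _ h2
    simp at hf; subst hf
    have heE := trap2 hT hB h2 (by simp) h3
    obtain ⟨a1, a2, a3, a4, a5, a6⟩ := h1
    obtain ⟨b1, b2, b3, b4, b5, b6⟩ := h2
    obtain ⟨c1, c2, c3, c4, c5, c6⟩ := h3
    obtain ⟨t1, t2, t3⟩ := hT
    have hE : ∀ q ∈ E, q = c := by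
      intro q hq
      by_contra hqc
      have hqe : q ≠ e := by rintro rfl; contradiction
      have : adj q e := by
        refine (t3 q e hqe).resolve_right fun h => ?_
        have := a6 e (by simp) q (c2 hq) h
        simp [hqe, hqc] at this
      have := c6 q hq e b1 this
      simp [heE] at this
      simp [this] at b3
    obtain ⟨r, hr, hr'⟩ : ∃ r ∈ B, r ∉ ({c, e, f'} : Finset V) := by
      apply exists_mem_notMem_of_card_lt_card
      exact lt_of_le_of_lt card_le_three (by omega)
    refine hB.closed {c, e, f'} ?_ a1 (by simp) hr hr'
    obtain ⟨y, hy⟩ := c4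
    have := hE y hy
    subst this
    intro u hu huB w hw ha
    simp only [mem_insert, mem_singleton] at hu ⊢
    rcases hu with rfl | rfl | rfl
    · have := c6 u hy w hw ha
      grind
    · have := a6 u (by simp) w hw ha
      grind
    · have := b6 u (by simp) w hw ha
      grind
  have s0 : ∃ c E, Trap adj B c E := by
    have hne : B.Nonempty := by rw [← card_pos]; omega
    obtain ⟨u, hu, w, hw, hwB, ha⟩ := hW.1 B hBW hne hneq
    exact ⟨u, trap_of_crit hu (hcrit u hu ⟨w, hw, hwB, ha⟩)⟩
  have hpos : ∀ c E, Trap adj B c E → 1 ≤ E.card := fun c E h => h.2.2.2.1.card_pos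
  have s5 : ∃ n, ∃ c E, Trap adj B c E ∧ 2 ≤ E.card ∧ E.card = n := by
    obtain ⟨c, E, h⟩ := s0
    by_cases h2 : 2 ≤ E.card
    · exact ⟨_, c, E, h, h2, rfl⟩
    have := hpos c E h
    obtain ⟨e, rfl⟩ := card_eq_one.1 (show E.card = 1 by omega)
    obtain ⟨e', he, E', h'⟩ := s1 _ _ h
    simp at he; subst he
    by_cases h3 : 2 ≤ E'.card
    · exact ⟨_, _, E', h', h3, rfl⟩
    have := hpos _ E' h'
    obtain ⟨f, rfl⟩ := card_eq_one.1 (show E'.card = 1 by omega)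
    exact (s4 _ _ _ h h').elim
  obtain ⟨c, E, h, h2, hn⟩ := Nat.find_spec s5
  have hmin : ∀ c' E', Trap adj B c' E' → E'.card < E.card → ∃ f, E' = {f} := by
    intro c' E' h' hlt
    rw [hn] at hlt
    have := Nat.find_min s5 hlt
    push Not at this
    have := this c' E' h'
    have := hpos _ _ h'
    exact card_eq_one.1 (by by_contra; grind)
  have step : ∀ e ∈ E, ∀ E', Trap adj B e E' → ∃ f ∈ E, Trap adj B e {f} := by
    intro e he E' h'
    have := trap3 hT hB h he h' (by rintro rfl; simp at h2)
    obtain ⟨f, hf⟩ := hmin _ _ this (card_lt_card (by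
      refine ⟨inter_subset_left, fun hs => ?_⟩
      exact this.2.2.1 (hs he)))
    rw [hf] at this
    exact ⟨f, by have : f ∈ E ∩ E' := by simp [hf]
                 exact (mem_inter.1 this).1, this⟩
  obtain ⟨e, he, E', h'⟩ := s1 _ _ h
  obtain ⟨f, hf, h''⟩ := step e he E' h'
  obtain ⟨f', hf', E'', h3⟩ := s1 _ _ h''
  simp at hf'; subst hf'
  obtain ⟨g, hg, h4⟩ := step _ hf E'' h3
  exact s4 _ _ _ h'' h4

theorem shrink (hT : IsTournament adj) {W B : Finset V} (hW : Two adj W) (hB : Str adj B)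
    (hBW : B ⊆ W) (hneq : B ≠ W) (m : ℕ) (hm : 3 ≤ m) (hmB : m ≤ B.card) :
    ∃ B' ⊆ B, B'.card = m ∧ Str adj B' ∧
      ∀ U ⊆ B \ B', U.Nonempty → ∃ u ∈ U, ∃ a ∈ W, a ∉ B' ∧ a ∉ U ∧ adj u a := by
  induction hmB using Nat.decreasingInduction with
  | self =>
    refine ⟨B, Subset.rfl, rfl, hB, ?_⟩
    intro U hU hne
    simp at hU; simp [hU] at hne
  | of_succ m hm' ih =>
    obtain ⟨B', h1, h2, h3, h4⟩ := ih (by omega)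
    obtain ⟨b, hb, hs, a, ha, haB, hba⟩ := lemma_star hT hW h3 (h1.trans hBW)
      (by rintro rfl; exact hneq (Subset.antisymm hBW h1)) (by omega)
    refine ⟨B'.erase b, (erase_subset _ _).trans h1, by rw [card_erase_of_mem hb]; omega, hs, ?_⟩
    intro U hU hne
    by_cases hbU : U = {b}
    · subst hbU
      exact ⟨b, by simp, a, ha, by simp [haB], by rintro h; simp at h; subst h; contradiction, hba⟩
    · obtain ⟨u, hu, w, hw, hwB, hwU, hadj⟩ := h4 (U.erase b) (by intro x hx; have := hU (mem_of_mem_erase hx); simp at this hx ⊢; grind)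
        (by
          obtain ⟨z, hz⟩ := hne
          by_contra hcon
          rw [not_nonempty_iff_eq_empty] at hcon
          rcases (erase_eq_empty_iff _ _).1 hcon with h | h
          · simp [h] at hz
          · exact hbU h)
      by_cases hwU' : w ∈ U
      · have : w = b := by by_contra hh; exact hwU (by simp [hh, hwU'])
        subst this; contradiction
      · exact ⟨u, by grind, w, hw, by grind, hwU', hadj⟩

theorem init_comp (hT : IsTournament adj) (S : Finset V) (hS : S.Nonempty) :
    ∃ C ⊆ S, C.Nonempty ∧ Str adj C ∧ ∀ c ∈ C, ∀ d ∈ S, d ∉ C → adj c d := by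
  have hex : ∃ n, ∃ C ⊆ S, C.Nonempty ∧ (∀ c ∈ C, ∀ d ∈ S, d ∉ C → adj c d) ∧ C.card = n :=
    ⟨_, S, Subset.rfl, hS, by grind, rfl⟩
  obtain ⟨C, h1, h2, h3, h4⟩ := Nat.find_spec hex
  refine ⟨C, h1, h2, ?_, h3⟩
  by_contra hcon
  obtain ⟨U, u1, u2, ⟨q, q1, q2⟩, u4⟩ := not_str hcon
  have hlt : (C \ U).card < Nat.find hex := by
    rw [← h4]
    exact card_lt_card ⟨sdiff_subset, fun hs => by
      obtain ⟨z, hz⟩ := u2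
      have := hs (u1 hz); simp [hz] at this⟩
  refine Nat.find_min hex hlt ⟨C \ U, sdiff_subset.trans h1, ⟨q, by simp [q1, q2]⟩, ?_, rfl⟩
  intro c hc d hd hdC
  simp only [mem_sdiff, not_and, not_not] at hc hdC
  by_cases hd' : d ∈ C
  · have hdU := hdC hd'
    refine (hT.2.2 c d (by rintro rfl; exact hc.2 hdU)).resolve_right fun h => ?_
    exact hc.2 (u4 d hdU c hc.1 h)
  · exact h3 c hc.1 d hd hd'

theorem str_card_ne_two (hT : IsTournament adj) {C : Finset V} (hC : Str adj C) : C.card ≠ 2 := by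
  intro h
  obtain ⟨v, hv⟩ : C.Nonempty := by rw [← card_pos]; omega
  obtain ⟨a, ha, b, hb, h1, h2, h3⟩ := str_triangle_through hT hC hv (by omega)
  have : ({v, a, b} : Finset V).card ≤ 2 := by
    rw [← h]; exact card_le_card (by grind)
  have h3 : ({v, a, b} : Finset V).card = 3 := by
    rw [card_eq_three]
    refine ⟨v, a, b, ?_, ?_, ?_, rfl⟩
    · rintro rfl; exact hT.1 _ h1
    · rintro rfl; exact hT.1 _ h3
    · rintro rfl; exact hT.1 _ h2
  omega
end TT
end

section
namespace TT
open Classical Finset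
variable {adj : V → V → Prop}
set_option linter.unusedSectionVars false

def Rch (adj : V → V → Prop) (r : V) (X : Finset V) : Prop :=
  ∀ U ⊆ X, U.Nonempty → ∃ u ∈ U, ∃ a, (a ∈ X ∧ a ∉ U ∨ a = r) ∧ adj a u

theorem lh_step {P2 P1 : Finset V} {v w : V} (hw : w ∉ P2) (hR : Rch adj w P2)
    (hne : P2.Nonempty)
    (H : ∀ U ⊆ P2, U.Nonempty → ∀ z, z ∉ U → ∃ a, (a ∈ P1 ∨ a ∈ P2 ∨ a = v ∨ a = w) ∧ a ∉ U ∧ a ≠ z ∧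
      ∃ u ∈ U, adj a u) :
    ∃ z ∈ P2, (∃ a, (a ∈ P1 ∨ a = v) ∧ adj a z) ∧ Rch adj w (P2.erase z) := by
  let Bd : V → Finset V → Prop := fun z D => D ⊆ P2.erase z ∧
    ∀ d ∈ D, ∀ a, (a ∈ P2 ∧ a ≠ z ∧ a ∉ D) ∨ a = w → ¬ adj a d
  let DD : V → Finset V := fun z => (P2.erase z).filter (fun d => ∃ D, Bd z D ∧ d ∈ D)
  have hDD : ∀ z, Bd z (DD z) := by
    intro z
    refine ⟨filter_subset _ _, ?_⟩
    intro d hd a ha hadj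
    simp only [DD, mem_filter] at hd ha
    obtain ⟨hd1, D, hD, hdD⟩ := hd
    refine hD.2 d hdD a ?_ hadj
    rcases ha with ⟨a1, a2, a3⟩ | ha
    · refine .inl ⟨a1, a2, fun h => a3 ⟨by simp [a1, a2], D, hD, h⟩⟩
    · exact .inr ha
  have hmax : ∀ z D, Bd z D → D ⊆ DD z := by
    intro z D hD d hd
    simp only [DD, mem_filter]
    exact ⟨hD.1 hd, D, hD, hd⟩
  have hesc : ∃ n, ∃ z ∈ P2, (∃ a, (a ∈ P1 ∨ a = v) ∧ adj a z) ∧ (DD z).card = n := by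
    obtain ⟨a, h1, h2, h3, u, hu, hau⟩ := H P2 Subset.rfl hne w hw
    exact ⟨_, u, hu, ⟨a, by grind, hau⟩, rfl⟩
  obtain ⟨z, hz, hez, hn⟩ := Nat.find_spec hesc
  refine ⟨z, hz, hez, ?_⟩
  by_contra hcon
  unfold Rch at hcon
  push Not at hcon
  obtain ⟨U, hU, hUne, hU2⟩ := hcon
  have hUB : Bd z U := ⟨hU, by
    intro d hd a ha
    exact hU2 d hd a (by simp; tauto)⟩
  have hDne : (DD z).Nonempty := hUne.mono (hmax z U hUB)
  have hDz : DD z ⊆ P2 := (filter_subset _ _).trans (erase_subset _ _)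
  have hzD : z ∉ DD z := by simp [DD]
  obtain ⟨a, h1, h2, h3, u, hu, hau⟩ := H (DD z) hDz hDne z hzD
  have haP : a ∈ P1 ∨ a = v := by
    by_contra hc
    refine (hDD z).2 u hu a ?_ hau
    rcases h1 with h | h | h | h
    · exact absurd (.inl h) hc
    · exact .inl ⟨h, h3, h2⟩
    · exact absurd (.inr h) hc
    · exact .inr h
  have huP : u ∈ P2 := hDz hu
  have huz : u ≠ z := by rintro rfl; contradiction
  have hDu : DD u ⊆ P2 := (filter_subset _ _).trans (erase_subset _ _)
  have huD : u ∉ DD u := by simp [DD]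
  have hzDu : z ∉ DD u := by
    intro hzz
    obtain ⟨t, ht, b, hb, hbt⟩ := hR (DD z ∪ DD u) (union_subset hDz hDu) ⟨u, by simp [hu]⟩
    simp only [mem_union, not_or] at ht hb
    rcases ht with ht | ht
    · refine (hDD z).2 t ht b ?_ hbt
      rcases hb with ⟨b1, b2, b3⟩ | hb
      · exact .inl ⟨b1, by rintro rfl; contradiction, b2⟩
      · exact .inr hb
    · refine (hDD u).2 t ht b ?_ hbt
      rcases hb with ⟨b1, b2, b3⟩ | hb
      · exact .inl ⟨b1, by rintro rfl; contradiction, b3⟩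
      · exact .inr hb
  have hsub : DD z ∪ DD u ⊆ DD z := by
    apply hmax
    refine ⟨?_, ?_⟩
    · intro t ht
      simp only [mem_union] at ht
      simp only [mem_erase]
      rcases ht with ht | ht
      · exact ⟨by rintro rfl; contradiction, hDz ht⟩
      · exact ⟨by rintro rfl; contradiction, hDu ht⟩
    · intro d hd b hb hbd
      simp only [mem_union, not_or] at hd hb
      rcases hd with ht | ht
      · refine (hDD z).2 d ht b ?_ hbd
        rcases hb with ⟨b1, b2, b3, b4⟩ | hb
        · exact .inl ⟨b1, b2, b3⟩
        · exact .inr hb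
      · refine (hDD u).2 d ht b ?_ hbd
        rcases hb with ⟨b1, b2, b3, b4⟩ | hb
        · exact .inl ⟨b1, by rintro rfl; contradiction, b4⟩
        · exact .inr hb
  have hlt : (DD u).card < Nat.find hesc := by
    rw [← hn]
    refine card_lt_card ⟨fun t ht => hsub (by simp [ht]), fun hs => huD (hs hu)⟩
  exact Nat.find_min hesc hlt ⟨u, huP, ⟨a, haP, hau⟩, rfl⟩

theorem lh {P : Finset V} {v w : V} (hv : v ∉ P) (hw : w ∉ P)
    (H : ∀ U ⊆ P, U.Nonempty → ∀ z, z ∉ U → ∃ a, (a ∈ P ∨ a = v ∨ a = w) ∧ a ∉ U ∧ a ≠ z ∧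
      ∃ u ∈ U, adj a u) (p : ℕ) (hp : p ≤ P.card) :
    ∃ P1 ⊆ P, P1.card = p ∧ Rch adj v P1 ∧ Rch adj w (P \ P1) := by
  induction p with
  | zero =>
    refine ⟨∅, by simp, by simp, ?_, ?_⟩
    · intro U hU hne; simp at hU; simp [hU] at hne
    · intro U hU hne
      simp only [sdiff_empty] at hU ⊢
      obtain ⟨a, h1, h2, h3, u, hu, hau⟩ := H U hU hne v (fun h => hv (hU h))
      exact ⟨u, hu, a, by tauto, hau⟩
  | succ p ih =>
    obtain ⟨P1, h1, h2, h3, h4⟩ := ih (by omega)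
    obtain ⟨z, hz, ⟨a, ha, haz⟩, hR⟩ := lh_step (P1 := P1) (v := v) (w := w) (P2 := P \ P1)
      (by simp [hw]) h4 (by
        rw [← card_pos, card_sdiff_of_subset h1]; omega) (by
        intro U hU hne z hz
        obtain ⟨a, a1, a2, a3, a4⟩ := H U (hU.trans sdiff_subset) hne z hz
        refine ⟨a, ?_, a2, a3, a4⟩
        simp only [mem_sdiff]; tauto)
    simp only [mem_sdiff] at hz
    refine ⟨insert z P1, by grind, by rw [card_insert_of_notMem hz.2, h2], ?_, ?_⟩
    · intro U hU hne
      by_cases hUz : (U.erase z).Nonempty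
      · obtain ⟨u, hu, b, hb, hbu⟩ := h3 (U.erase z) (by grind) hUz
        refine ⟨u, by grind, b, ?_, hbu⟩
        grind
      · rw [not_nonempty_iff_eq_empty, erase_eq_empty_iff] at hUz
        rcases hUz with h | h
        · simp [h] at hne
        · subst h
          refine ⟨z, by simp, a, ?_, haz⟩
          grind
    · convert hR using 1
      grind

variable [Fintype V]

def Good (adj : V → V → Prop) (L : ℕ) : Prop := ∃ A : Finset V, A.card = L ∧ Str adj A ∧ Str adj Aᶜ

theorem Good.flip {L : ℕ} (h : Good adj L) : Good (flip adj) L := by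
  obtain ⟨A, h1, h2, h3⟩ := h
  exact ⟨A, h1, h2.flip, h3.flip⟩

theorem good_symm {L M : ℕ} (h : Good adj L) (hLM : L + M = Fintype.card V) : Good adj M := by
  obtain ⟨A, h1, h2, h3⟩ := h
  exact ⟨Aᶜ, by rw [card_compl]; omega, h3, by simpa⟩

theorem init_vertex (hT : IsTournament adj) (S : Finset V) (hS : S.Nonempty) :
    ∃ w ∈ S, ∀ U ⊆ S, U.Nonempty → w ∉ U → ∃ u ∈ U, ∃ a ∈ S, a ∉ U ∧ adj a u := by
  obtain ⟨C, h1, ⟨w, hw⟩, h3, h4⟩ := init_comp hT S hS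
  refine ⟨w, h1 hw, ?_⟩
  intro U hU ⟨u, hu⟩ hwU
  by_cases hUC : ∃ c ∈ C, c ∈ U
  · obtain ⟨c, hc, hcU⟩ := hUC
    obtain ⟨a, a1, a2, b, b1, b2, hab⟩ := h3.flip.cut U hc hcU hw hwU
    exact ⟨a, a2, b, h1 b1, b2, hab⟩
  · push Not at hUC
    exact ⟨u, hu, w, h1 hw, hwU, h4 w hw u (hU hu) (fun h => hUC u h hu)⟩

theorem nt_hyp (hT : IsTournament adj) {k : ℕ}
    (K : ∀ R : Finset V, R.card < k → Str adj Rᶜ) {R P Q : Finset V} (hR : R.card = k)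
    (hRP : Disjoint R P) (hRQ : Disjoint R Q) (hPQ : Disjoint P Q) (hcov : R ∪ P ∪ Q = univ)
    (hdom : ∀ p ∈ P, ∀ q ∈ Q, adj p q) (hQ2 : 2 ≤ Q.card)
    {v w : V} (hv : v ∈ R) (hw : w ∈ R) (hvw : v ≠ w) :
    ∀ U ⊆ P, U.Nonempty → ∀ z, z ∉ U → ∃ a, (a ∈ P ∨ a = v ∨ a = w) ∧ a ∉ U ∧ a ≠ z ∧
      ∃ u ∈ U, adj a u := by
  intro U hU ⟨u0, hu0⟩ z hz
  have hcard : (insert z ((R.erase v).erase w)).card < k := by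
    have h1 : ((R.erase v).erase w).card = k - 2 := by
      rw [card_erase_of_mem (by simp [hw, hvw.symm]), card_erase_of_mem hv]; omega
    have h2 := card_insert_le z ((R.erase v).erase w)
    have h3 : ({v, w} : Finset V).card ≤ R.card := card_le_card (by grind)
    rw [card_pair hvw] at h3
    omega
  obtain ⟨q, hq, hqz⟩ : ∃ q ∈ Q, q ∉ ({z} : Finset V) :=
    exists_mem_notMem_of_card_lt_card (by simp; omega)
  rw [disjoint_left] at hRP hRQ hPQ
  have hu0P := hU hu0
  obtain ⟨u, u1, u2, a, a1, a2, hau⟩ := (K _ hcard).flip.cut U (a := u0) (b := q) (by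
    simp; refine ⟨by rintro rfl; contradiction, Or.inr (Or.inr fun h => hRP h hu0P)⟩) hu0 (by
    simp at hqz ⊢; exact ⟨hqz, Or.inr (Or.inr fun h => hRQ h hq)⟩) (fun h => hPQ (hU h) hq)
  refine ⟨a, ?_, a2, by rintro rfl; simp at a1, u, u2, hau⟩
  have : a ∈ R ∪ P ∪ Q := by rw [hcov]; simp
  have haQ : a ∉ Q := fun h => hT.2.1 _ _ (hdom u (hU u2) a h) hau
  simp at a1 this
  tauto

theorem nt_fail (hT : IsTournament adj) {k : ℕ} (hk : 2 ≤ k)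
    (K : ∀ R : Finset V, R.card < k → Str adj Rᶜ) {R P Q : Finset V} (hR : R.card = k)
    (hRP : Disjoint R P) (hRQ : Disjoint R Q) (hPQ : Disjoint P Q) (hcov : R ∪ P ∪ Q = univ)
    (hdom : ∀ p ∈ P, ∀ q ∈ Q, adj p q) (hP2 : 2 ≤ P.card) (hQ2 : 2 ≤ Q.card)
    {L : ℕ} (hL : 3 ≤ L) (hLn : L + k + 1 ≤ Fintype.card V) : Good adj L := by
  obtain ⟨v, hv⟩ : R.Nonempty := by rw [← card_pos]; omega
  have hR2 : (R.erase v).Nonempty := by rw [← card_pos, card_erase_of_mem hv]; omega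
  obtain ⟨w1, hw1, hw1'⟩ := init_vertex hT _ hR2
  obtain ⟨wb, hwb, hwb'⟩ := init_vertex (flipT hT) _ hR2
  simp only [mem_erase] at hw1 hwb
  have hc : R.card + P.card + Q.card = Fintype.card V := by
    rw [← card_univ, ← hcov, card_union_of_disjoint (by rw [disjoint_union_left]; exact ⟨hRQ, hPQ⟩),
      card_union_of_disjoint hRP]
  have H1 := nt_hyp hT K hR hRP hRQ hPQ hcov hdom hQ2 hv hwb.2 hwb.1.symm
  have H2 := nt_hyp (flipT hT) (fun R hR => (K R hR).flip) hR hRQ hRP hPQ.symm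
    (by rw [← hcov]; ext; simp; tauto) (fun p hp q hq => hdom q hq p hp) hP2 hv hw1.2 hw1.1.symm
  rw [disjoint_left] at hRP hRQ hPQ
  obtain ⟨p, q, hp1, hp2, hq1, hq2, hpq⟩ : ∃ p q, 1 ≤ p ∧ p + 1 ≤ P.card ∧ 1 ≤ q ∧ q + 1 ≤ Q.card ∧
      1 + p + q = L := by
    by_cases h : L ≤ P.card
    · exact ⟨L - 2, 1, by omega, by omega, by omega, by omega, by omega⟩
    · exact ⟨P.card - 1, L - P.card, by omega, by omega, by omega, by omega, by omega⟩
  obtain ⟨P1, hP1, cP1, r1, r2⟩ := lh (hRP hv) (hRP hwb.2) H1 p (by omega)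
  obtain ⟨Q1, hQ1, cQ1, r3, r4⟩ := lh (hRQ hv) (hRQ hw1.2) H2 q (by omega)
  have P1ne : P1.Nonempty := by rw [← card_pos]; omega
  have Q1ne : Q1.Nonempty := by rw [← card_pos]; omega
  have P2ne : (P \ P1).Nonempty := by rw [← card_pos, card_sdiff_of_subset hP1]; omega
  have Q2ne : (Q \ Q1).Nonempty := by rw [← card_pos, card_sdiff_of_subset hQ1]; omega
  obtain ⟨p1, hp1'⟩ := P1ne
  obtain ⟨q1, hq1'⟩ := Q1ne
  obtain ⟨p2, hp2'⟩ := P2ne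
  have hvP1 : v ∉ P1 := fun h => hRP hv (hP1 h)
  have hvQ1 : v ∉ Q1 := fun h => hRQ hv (hQ1 h)
  refine ⟨insert v (P1 ∪ Q1), ?_, ?_, ?_⟩
  · rw [card_insert_of_notMem (by simp [hvP1, hvQ1]), card_union_of_disjoint, cP1, cQ1]
    · omega
    · rw [disjoint_left]; intro a ha hb; exact hPQ (hP1 ha) (hQ1 hb)
  · refine str_root v ?_ ?_
    · intro U hU hne hvU
      by_cases hUQ : (U ∩ Q1).Nonempty
      · obtain ⟨u, hu, a, ha, hau⟩ := r3 _ inter_subset_right hUQ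
        exact ⟨u, by grind, a, by grind, by grind, hau⟩
      · rw [not_nonempty_iff_eq_empty, ← disjoint_iff_inter_eq_empty, disjoint_left] at hUQ
        obtain ⟨u, hu⟩ := hne
        exact ⟨u, hu, q1, by simp [hq1'], fun h => hUQ h hq1', hdom _ (hP1 (by grind)) _ (hQ1 hq1')⟩
    · intro U hU hne hvU
      by_cases hUQ : (U ∩ P1).Nonempty
      · obtain ⟨u, hu, a, ha, hau⟩ := r1 _ inter_subset_right hUQ
        exact ⟨u, by grind, a, by grind, by grind, hau⟩
      · rw [not_nonempty_iff_eq_empty, ← disjoint_iff_inter_eq_empty, disjoint_left] at hUQ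
        obtain ⟨u, hu⟩ := hne
        exact ⟨u, hu, p1, by simp [hp1'], fun h => hUQ h hp1', hdom _ (hP1 hp1') _ (hQ1 (by grind))⟩
  · have hcompl : (insert v (P1 ∪ Q1))ᶜ = R.erase v ∪ (P \ P1) ∪ (Q \ Q1) := by
      ext x
      have : x ∈ R ∪ P ∪ Q := by rw [hcov]; simp
      simp only [mem_compl, mem_insert, mem_union, mem_erase, mem_sdiff] at this ⊢
      have a1 := @hRP x
      have a2 := @hRQ x
      have a3 := @hPQ x
      have a4 := @hP1 x
      have a5 := @hQ1 x
      clear H1 H2 r1 r2 r3 r4 hw1' hwb' hdom hcov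
      by_cases hxv : x = v
      · subst hxv; simp [a1 hv, a2 hv]
      · grind
    rw [hcompl]
    refine str_root wb ?_ ?_
    · intro U hU hne hvU
      by_cases h1 : (U ∩ R.erase v).Nonempty
      · obtain ⟨u, hu, a, ha, haU, hau⟩ := hwb' _ inter_subset_right h1 (by simp [hvU])
        exact ⟨u, by grind, a, by grind, by grind, hau⟩
      have h1' : ∀ x ∈ U, x ∉ R.erase v := fun x hx hx' => h1 ⟨x, mem_inter.2 ⟨hx, hx'⟩⟩
      by_cases h2 : (U ∩ (Q \ Q1)).Nonempty
      · obtain ⟨u, hu, a, ha, hau⟩ := r4 _ inter_subset_right h2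
        refine ⟨u, by grind, a, by grind, ?_, hau⟩
        rcases ha with ha | ha
        · grind
        · subst ha; intro h; exact h1' _ h (by simp [hw1])
      have h2' : ∀ x ∈ U, x ∉ Q \ Q1 := fun x hx hx' => h2 ⟨x, mem_inter.2 ⟨hx, hx'⟩⟩
      obtain ⟨u, hu⟩ := hne
      obtain ⟨q2, hq2'⟩ := Q2ne
      exact ⟨u, hu, q2, by grind, fun h => h2' _ h hq2', hdom _ (by grind) _ (by grind)⟩
    · intro U hU hne hvU
      by_cases h1 : (U ∩ (P \ P1)).Nonempty
      · obtain ⟨u, hu, a, ha, hau⟩ := r2 _ inter_subset_right h1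
        exact ⟨u, by grind, a, by grind, by grind, hau⟩
      have h1' : ∀ x ∈ U, x ∉ P \ P1 := fun x hx hx' => h1 ⟨x, mem_inter.2 ⟨hx, hx'⟩⟩
      by_cases h2 : (U ∩ (Q \ Q1)).Nonempty
      · obtain ⟨u, hu⟩ := h2
        exact ⟨u, by grind, p2, by grind, fun h => h1' _ h hp2', hdom _ (by grind) _ (by grind)⟩
      have h2' : ∀ x ∈ U, x ∉ Q \ Q1 := fun x hx hx' => h2 ⟨x, mem_inter.2 ⟨hx, hx'⟩⟩
      by_cases hw : w1 ∈ U
      · obtain ⟨u, hu, a, ha, hau⟩ := r4 _ Subset.rfl Q2ne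
        have : a = w1 := by tauto
        subst this
        exact ⟨a, hw, u, by grind, fun h => h2' _ h hu, hau⟩
      · obtain ⟨u, hu, a, ha, haU, hau⟩ := hw1' U (by grind) hne hw
        exact ⟨u, hu, a, by grind, haU, hau⟩
end TT
end

section
namespace TT
open Classical Finset
variable {adj : V → V → Prop}
set_option linter.unusedSectionVars false
variable [Fintype V]

noncomputable def outN (adj : V → V → Prop) (v : V) : Finset V := univ.filter (fun w => adj v w)
noncomputable def inN (adj : V → V → Prop) (v : V) : Finset V := univ.filter (fun w => adj w v)

theorem mem_outN {v w : V} : w ∈ outN adj v ↔ adj v w := by simp [outN]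
theorem mem_inN {v w : V} : w ∈ inN adj v ↔ adj w v := by simp [inN]

structure Ctx (adj : V → V → Prop) (k : ℕ) : Prop where
  hT : IsTournament adj
  hk : 2 ≤ k
  hn : k + 1 ≤ Fintype.card V
  K : ∀ R : Finset V, R.card < k → Str adj Rᶜ
  NT : ∀ R E : Finset V, R.card = k → E.Nonempty → Disjoint E R →
    (∀ e ∈ E, ∀ w, adj e w → w ∈ E ∨ w ∈ R) → E.card ≤ 1 ∨ ((R ∪ E)ᶜ).card ≤ 1

theorem Ctx.irr {k : ℕ} (h : Ctx adj k) (v : V) : ¬ adj v v := h.hT.1 v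
theorem Ctx.asym {k : ℕ} (h : Ctx adj k) {u v : V} (h1 : adj u v) (h2 : adj v u) : False :=
  h.hT.2.1 u v h1 h2
theorem Ctx.tot {k : ℕ} (h : Ctx adj k) {u v : V} (h1 : u ≠ v) (h2 : ¬ adj v u) : adj u v :=
  (h.hT.2.2 u v h1).resolve_right h2
theorem Ctx.ne {k : ℕ} (h : Ctx adj k) {u v : V} (h1 : adj u v) : u ≠ v := by
  rintro rfl; exact h.irr _ h1

theorem Ctx.flip {k : ℕ} (h : Ctx adj k) : Ctx (flip adj) k := by
  refine ⟨flipT h.hT, h.hk, h.hn, fun R hR => (h.K R hR).flip, ?_⟩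
  intro R E hR hE hd hcl
  rw [disjoint_left] at hd
  by_cases hne : ((R ∪ E)ᶜ).Nonempty
  · have := h.NT R (R ∪ E)ᶜ hR hne (by rw [disjoint_left]; intro a; simp; tauto) (by
      intro e he w hw
      simp only [mem_compl, mem_union, not_or] at he ⊢
      by_contra hc
      have hwE : w ∈ E := by tauto
      rcases hcl w hwE e hw with h | h <;> tauto)
    have he : (R ∪ (R ∪ E)ᶜ)ᶜ = E := by
      ext a
      have := @hd a
      simp; tauto
    rw [he] at this
    exact this.symm
  · rw [not_nonempty_iff_eq_empty] at hne
    right; simp [hne]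

theorem Ctx.dout {k : ℕ} (h : Ctx adj k) (v : V) : k ≤ (outN adj v).card := by
  by_contra hc
  have hs := h.K (outN adj v) (by omega)
  obtain ⟨w, hw, hw'⟩ : ∃ w ∈ (univ : Finset V), w ∉ insert v (outN adj v) := by
    apply exists_mem_notMem_of_card_lt_card
    have := card_insert_le v (outN adj v)
    have := h.hn
    rw [card_univ]; omega
  simp only [mem_insert, not_or, mem_outN] at hw'
  refine hs.closed {v} ?_ (a := v) (b := w) (by simp [mem_outN, h.irr]) (by simp) (by simp [mem_outN, hw'.2]) (by simp [hw'.1])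
  intro u hu _ w hw hadj
  simp at hu; subst hu
  simp [mem_outN, hadj] at hw

theorem Ctx.din {k : ℕ} (h : Ctx adj k) (v : V) : k ≤ (inN adj v).card := h.flip.dout v

theorem Ctx.deg {k : ℕ} (h : Ctx adj k) (v : V) :
    (inN adj v).card + (outN adj v).card + 1 = Fintype.card V := by
  have h1 : insert v (inN adj v ∪ outN adj v) = univ := by
    ext w
    simp only [mem_insert, mem_union, mem_inN, mem_outN, mem_univ, iff_true]
    by_cases hw : w = v
    · exact .inl hw
    · exact .inr (h.hT.2.2 w v hw)
  rw [← card_univ, ← h1, card_insert_of_notMem (by simp [mem_inN, mem_outN, h.irr]), card_union_of_disjoint]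
  rw [disjoint_left]; intro a; simp only [mem_inN, mem_outN]; exact fun h1 h2 => h.asym h1 h2

/-- x → y → s → x and every other vertex lies between. -/
theorem str_xy {A : Finset V} {x y s : V} (hx : x ∈ A) (hy : y ∈ A) (hs : s ∈ A)
    (hxy : adj x y) (hys : adj y s) (hsx : adj s x)
    (h : ∀ v ∈ A, v = x ∨ v = y ∨ (adj x v ∧ adj v y) ∨ (adj y v ∧ adj v x)) : Str adj A := by
  refine str_root x ?_ ?_
  · intro U hU ⟨u, hu⟩ hxU
    by_cases hyU : y ∈ U
    · by_cases hsU : s ∈ U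
      · exact ⟨s, hsU, x, hx, hxU, hsx⟩
      · exact ⟨y, hyU, s, hs, hsU, hys⟩
    · rcases h u (hU hu) with h | h | h | h
      · subst h; contradiction
      · subst h; contradiction
      · exact ⟨u, hu, y, hy, hyU, h.2⟩
      · exact ⟨u, hu, x, hx, hxU, h.2⟩
  · intro U hU ⟨u, hu⟩ hxU
    by_cases hyU : y ∈ U
    · exact ⟨y, hyU, x, hx, hxU, hxy⟩
    · rcases h u (hU hu) with h | h | h | h
      · subst h; contradiction
      · subst h; contradiction
      · exact ⟨u, hu, x, hx, hxU, h.1⟩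
      · exact ⟨u, hu, y, hy, hyU, h.1⟩

theorem exists_mid (hT : IsTournament adj) {S : Finset V} (hS : 3 ≤ S.card) :
    ∃ s ∈ S, (∃ i ∈ S, adj i s) ∧ (∃ o ∈ S, adj s o) := by
  obtain ⟨a, ha, b, hb, c, hc, hab, hac, hbc⟩ := two_lt_card.1 hS
  obtain ⟨h1, h2, h3⟩ := hT
  have := h3 a b hab
  have := h3 a c hac
  have := h3 b c hbc
  grind

theorem case_II {k : ℕ} (h : Ctx adj k) {x : V} (hx : (inN adj x).card = k)
    (hY : ¬ Str adj (outN adj x)) {L : ℕ} (hL : 3 ≤ L) (hLn : 2 * L ≤ Fintype.card V) :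
    Good adj L := by
  have hdeg := h.deg x
  have hdo := h.dout x
  have hk := h.hk
  have hT := h.hT
  have cl : ∀ E ⊆ outN adj x, E.Nonempty → (∃ q ∈ outN adj x, q ∉ E) →
      (∀ u ∈ E, ∀ w ∈ outN adj x, adj u w → w ∈ E) → E.card ≤ 1 := by
    intro E hE hne ⟨q, hq, hqE⟩ hcl
    have hES : ∀ e ∈ E, adj x e := fun e he => mem_outN.1 (hE he)
    have g1 : Disjoint E (inN adj x) := by
      rw [disjoint_left]; intro a ha hb
      exact h.asym (hES a ha) (mem_inN.1 hb)
    have g2 : ∀ e ∈ E, ∀ w, adj e w → w ∈ E ∨ w ∈ inN adj x := by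
      intro e he w hw
      by_cases hxw : adj x w
      · exact .inl (hcl e he w (mem_outN.2 hxw) hw)
      · refine .inr (mem_inN.2 (h.tot ?_ hxw))
        rintro rfl; exact h.asym hw (hES e he)
    rcases h.NT (inN adj x) E hx hne g1 g2 with h1 | h1
    · exact h1
    · exfalso
      have hxq := mem_outN.1 hq
      have : ({x, q} : Finset V) ⊆ (inN adj x ∪ E)ᶜ := by
        intro a ha
        simp only [mem_insert, mem_singleton] at ha
        simp only [mem_compl, mem_union, mem_inN, not_or]
        rcases ha with rfl | rfl
        · exact ⟨h.irr _, fun h' => h.irr _ (hES _ h')⟩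
        · exact ⟨fun h' => h.asym h' hxq, hqE⟩
      have := card_le_card this
      rw [card_pair (h.ne hxq)] at this
      omega
  obtain ⟨E, e1, e2, ⟨q, q1, q2⟩, e4⟩ := not_str hY
  have := cl E e1 e2 ⟨q, q1, q2⟩ e4
  obtain ⟨y, rfl⟩ := card_eq_one.1 (show E.card = 1 by have := e2.card_pos; omega)
  have hxy : adj x y := mem_outN.1 (e1 (by simp))
  have hyS : outN adj y = inN adj x := by
    apply eq_of_subset_of_card_le
    · intro w hw
      rw [mem_outN] at hw
      rw [mem_inN]
      by_contra hc
      have hwx : w ≠ x := by rintro rfl; exact h.asym hw hxy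
      have := e4 y (by simp) w (mem_outN.2 (h.tot hwx.symm hc)) hw
      simp at this; subst this; exact h.irr _ hw
    · rw [hx]; exact h.dout y
  set U := (outN adj x).erase y with hUdef
  have hyx : y ∈ outN adj x := mem_outN.2 hxy
  have hUc : U.card + 1 = (outN adj x).card := by
    rw [card_erase_of_mem hyx]; have := card_pos.2 ⟨y, hyx⟩; omega
  have hUmem : ∀ u, u ∈ U ↔ adj x u ∧ u ≠ y := by intro u; simp [U, mem_outN]; tauto
  have hymem : ∀ u, adj y u ↔ adj u x := by intro u; rw [← mem_outN (adj := adj) (v := y), hyS, mem_inN]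
  have hUy : ∀ u ∈ U, adj u y := by
    intro u hu
    rw [hUmem] at hu
    exact h.tot hu.2 (fun hc => h.asym hu.1 ((hymem u).1 hc))
  have hUs : Str adj U := by
    by_contra hc
    obtain ⟨E, f1, f2, ⟨p, p1, p2⟩, f4⟩ := not_str hc
    have hyE : y ∉ E := fun h => by simpa [hUmem] using f1 h
    have := cl (insert y E) (by intro a ha; rw [mem_insert] at ha; rcases ha with rfl | ha
                                · exact hyx
                                · exact erase_subset _ _ (f1 ha))
      (by simp) ⟨p, erase_subset _ _ p1, by
        simp only [mem_insert, not_or]; exact ⟨((hUmem p).1 p1).2, p2⟩⟩ (by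
        intro u hu w hw huw
        rw [mem_insert] at hu ⊢
        rcases hu with rfl | hu
        · exact (h.asym ((hymem w).1 huw) (mem_outN.1 hw)).elim
        · by_cases hwy : w = y
          · exact .inl hwy
          · exact .inr (f4 u hu w ((hUmem w).2 ⟨mem_outN.1 hw, hwy⟩) huw))
    rw [card_insert_of_notMem hyE] at this
    have := f2.card_pos
    omega
  have fin : ∀ B : Finset V, B.card = L → Str adj B → x ∉ B → y ∉ B → (∃ s, adj s x ∧ s ∉ B) →
      Good adj L := by
    rintro B hB hBs hxB hyB ⟨s, hs, hsB⟩
    refine ⟨B, hB, hBs, ?_⟩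
    refine str_xy (x := x) (y := y) (s := s) (by simpa) (by simpa) (by simpa) hxy ((hymem s).2 hs) hs ?_
    intro v hv
    by_cases h1 : v = x
    · exact .inl h1
    by_cases h2 : v = y
    · exact .inr (.inl h2)
    by_cases h3 : adj x v
    · exact .inr (.inr (.inl ⟨h3, hUy v ((hUmem v).2 ⟨h3, h2⟩)⟩))
    · have := h.tot h1 h3
      exact .inr (.inr (.inr ⟨(hymem v).2 this, this⟩))
  have hxU : x ∉ U := by rw [hUmem]; exact fun h' => h.irr _ h'.1
  have hyU : y ∉ U := by simp [hUmem]
  by_cases hLU : L ≤ U.card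
  · obtain ⟨b, hb⟩ : U.Nonempty := by rw [← card_pos]; omega
    obtain ⟨B, b1, b2, b3, b4⟩ := grow hT hUs hb L hL hLU
    obtain ⟨s, hs⟩ : (inN adj x).Nonempty := by rw [← card_pos]; omega
    refine fin B b4 b2 (fun h => hxU (b1 h)) (fun h => hyU (b1 h)) ⟨s, mem_inN.1 hs, fun h' => ?_⟩
    exact h.asym (mem_inN.1 hs) ((hUmem s).1 (b1 h')).1
  · have := str_card_ne_two hT hUs
    have hk3 : 3 ≤ k := by omega
    obtain ⟨s, hs, ⟨i, hi, his⟩, ⟨o, ho, hso⟩⟩ := exists_mid hT (S := inN adj x) (by omega)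
    have hsx := mem_inN.1 hs
    have hys := (hymem s).2 hsx
    have hsU : s ∉ U := by rw [hUmem]; exact fun h' => h.asym h'.1 hsx
    have hce : ∀ i ∈ inN adj x, i ≠ s → ∀ z, (insert z (((inN adj x).erase s).erase i)).card < k := by
      intro i hi his z
      have h1 := card_insert_le z (((inN adj x).erase s).erase i)
      rw [card_erase_of_mem (a := i) (by simp [hi, his]), card_erase_of_mem hs] at h1
      omega
    have m1 : ∃ a ∈ U, adj s a := by
      by_contra hc
      push Not at hc
      have : outN adj s ⊆ insert x (((inN adj x).erase s).erase i) := by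
        intro w hw
        rw [mem_outN] at hw
        simp only [mem_insert, mem_erase, mem_inN]
        by_cases hwx : w = x
        · exact .inl hwx
        refine .inr ⟨?_, (h.ne hw).symm, ?_⟩
        · rintro rfl; exact h.asym hw his
        · refine h.tot hwx fun hxw => hc w ((hUmem w).2 ⟨hxw, ?_⟩) hw
          rintro rfl; exact h.asym hw hys
      have := card_le_card this
      have := hce i hi (h.ne his) x
      have := h.dout s
      omega
    have m2 : ∃ b ∈ U, adj b s := by
      by_contra hc
      push Not at hc
      have : inN adj s ⊆ insert y (((inN adj x).erase s).erase o) := by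
        intro w hw
        rw [mem_inN] at hw
        simp only [mem_insert, mem_erase, mem_inN]
        by_cases hwy : w = y
        · exact .inl hwy
        refine .inr ⟨?_, h.ne hw, ?_⟩
        · rintro rfl; exact h.asym hw hso
        · refine h.tot ?_ fun hxw => hc w ((hUmem w).2 ⟨hxw, hwy⟩) hw
          rintro rfl; exact h.asym hw hsx
      have := card_le_card this
      have := hce o ho (h.ne hso).symm y
      have := h.din s
      omega
    obtain ⟨a, ha, hsa⟩ := m1
    obtain ⟨b, hb, hbs⟩ := m2
    refine fin (insert s U) (by rw [card_insert_of_notMem hsU]; omega) (str_insert hUs ha hb hsa hbs)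
      ?_ ?_ ⟨o, mem_inN.1 ho, ?_⟩
    · rw [mem_insert, not_or]; exact ⟨fun h' => h.ne hsx h'.symm, hxU⟩
    · rw [mem_insert, not_or]; exact ⟨fun h' => h.ne hys h', hyU⟩
    · rw [mem_insert, not_or]; exact ⟨fun h' => h.ne hso h'.symm, fun h' =>
        h.asym ((hUmem o).1 h').1 (mem_inN.1 ho)⟩
end TT
end

section
namespace TT
open Classical Finset
variable {adj : V → V → Prop}
set_option linter.unusedSectionVars false
variable [Fintype V]

theorem Ctx.tri {k : ℕ} (h : Ctx adj k) (x v : V) : v = x ∨ adj v x ∨ adj x v := by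
  by_cases hv : v = x
  · exact .inl hv
  · exact .inr (h.hT.2.2 v x hv)

theorem Ctx.two {k : ℕ} (h : Ctx adj k) {D : Finset V} (hD : D.card + 1 < k) : Two adj Dᶜ := by
  refine ⟨h.K D (by omega), ?_⟩
  intro c hc
  have : (Dᶜ).erase c = (insert c D)ᶜ := by ext; simp
  rw [this]
  exact h.K _ (lt_of_le_of_lt (card_insert_le _ _) hD)

theorem caseI_big {k : ℕ} (h : Ctx adj k) {x : V} (hx : (inN adj x).card = k)
    (hY : Str adj (outN adj x)) {C : Finset V} (hC : C ⊆ inN adj x) (hCs : Str adj C)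
    (hCd : ∀ c ∈ C, ∀ d ∈ inN adj x, d ∉ C → adj c d) (hC3 : 3 ≤ C.card)
    {L : ℕ} (hL : 3 ≤ L) (hLY : L + 1 ≤ (outN adj x).card) : Good adj L := by
  have hT := h.hT
  have hW : Two adj (inN adj x \ C)ᶜ := h.two (by rw [card_sdiff_of_subset hC]; have := h.hk; have := card_le_card hC; omega)
  have hxW : x ∈ (inN adj x \ C)ᶜ := by simp [mem_inN, h.irr]
  obtain ⟨B, b1, b2, b3, b4⟩ := shrink hT hW hY (by
    intro w hw; simp only [mem_compl, mem_sdiff, mem_inN, not_and]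
    intro h'; exact (h.asym h' (mem_outN.1 hw)).elim) (by
    intro he; rw [← he, mem_outN] at hxW; exact h.irr _ hxW) L hL (by omega)
  have hBY : ∀ b ∈ B, adj x b := fun b hb => mem_outN.1 (b1 hb)
  have hxB : x ∉ B := fun h' => h.irr _ (hBY _ h')
  have hCB : ∀ c, adj c x → c ∉ B := fun c hc h' => h.asym hc (hBY _ h')
  have hCx : ∀ c ∈ C, adj c x := fun c hc => mem_inN.1 (hC hc)
  refine ⟨B, b2, b3, str_root x ?_ ?_⟩
  · intro U hU ⟨u, hu⟩ hxU
    by_cases hUS : ∃ s ∈ U, adj s x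
    · obtain ⟨s, hs, hsx⟩ := hUS
      exact ⟨s, hs, x, by simpa, hxU, hsx⟩
    · push Not at hUS
      obtain ⟨u, hu, a, ha, haB, haU, hua⟩ := b4 U (by
        intro v hv
        rw [mem_sdiff, mem_outN]
        refine ⟨?_, by simpa using hU hv⟩
        rcases h.tri x v with h' | h' | h'
        · subst h'; contradiction
        · exact absurd h' (hUS v hv)
        · exact h') ⟨u, hu⟩
      exact ⟨u, hu, a, by simpa, haU, hua⟩
  · intro U hU ⟨u, hu⟩ hxU
    by_cases hUY : ∃ s ∈ U, adj x s
    · obtain ⟨s, hs, hsx⟩ := hUY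
      exact ⟨s, hs, x, by simpa, hxU, hsx⟩
    push Not at hUY
    have hUS : ∀ u ∈ U, adj u x := by
      intro v hv
      rcases h.tri x v with h' | h' | h'
      · subst h'; contradiction
      · exact h'
      · exact absurd h' (hUY v hv)
    by_cases hUC : ∃ c ∈ C, c ∉ U
    · obtain ⟨c, hc, hcU⟩ := hUC
      by_cases hUC' : ∃ c ∈ C, c ∈ U
      · obtain ⟨c', hc', hcU'⟩ := hUC'
        obtain ⟨a, a1, a2, w, w1, w2, haw⟩ := hCs.flip.cut U hc' hcU' hc hcU
        exact ⟨a, a2, w, by simp; exact hCB w (hCx w w1), w2, haw⟩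
      · push Not at hUC'
        exact ⟨u, hu, c, by simp; exact hCB c (hCx c hc), hcU, hCd c hc u (mem_inN.2 (hUS u hu)) (fun h => hUC' u h hu)⟩
    · push Not at hUC
      -- all of C in U; use an edge from Y∖B
      have hYB : (outN adj x \ B).Nonempty := by
        rw [← card_pos, card_sdiff_of_subset b1]; omega
      obtain ⟨w, hw, a, ha, haB, haU, hwa⟩ := b4 _ Subset.rfl hYB
      have hwY : adj x w := mem_outN.1 (mem_sdiff.1 hw).1
      have haC : a ∈ C := by
        simp only [mem_compl, mem_sdiff, mem_inN, mem_outN, not_and, not_not] at ha haU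
        rcases h.tri x a with h' | h' | h'
        · subst h'; exact (h.asym hwY hwa).elim
        · exact ha h'
        · exact absurd (haU h') haB
      exact ⟨a, hUC a haC, w, by simp; exact (mem_sdiff.1 hw).2, fun h' => h.asym hwY (hUS w h'), hwa⟩

theorem swap_y {k : ℕ} (h : Ctx adj k) {x : V} (hx : (inN adj x).card = k)
    (hY : Str adj (outN adj x)) {C : Finset V} (hC : C ⊆ inN adj x) (hC3 : 3 ≤ C.card)
    (hY4 : 4 ≤ (outN adj x).card) :
    ∃ y, adj x y ∧ Str adj ((outN adj x).erase y) ∧ ∃ c ∈ C, adj y c := by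
  have hW : Two adj (inN adj x \ C)ᶜ := h.two (by rw [card_sdiff_of_subset hC]; have := h.hk; have := card_le_card hC; omega)
  have hxW : x ∈ (inN adj x \ C)ᶜ := by simp [mem_inN, h.irr]
  obtain ⟨y, hy, hs, a, ha, haY, hya⟩ := lemma_star h.hT hW hY (by
    intro w hw; simp only [mem_compl, mem_sdiff, mem_inN, not_and]
    intro h'; exact (h.asym h' (mem_outN.1 hw)).elim) (by
    intro he; rw [← he, mem_outN] at hxW; exact h.irr _ hxW) hY4
  have hxy := mem_outN.1 hy
  refine ⟨y, hxy, hs, a, ?_, hya⟩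
  simp only [mem_compl, mem_sdiff, mem_inN, mem_outN, not_and, not_not] at ha haY
  rcases h.tri x a with h' | h' | h'
  · subst h'; exact (h.asym hxy hya).elim
  · exact ha h'
  · contradiction

theorem swap_fin {k : ℕ} (h : Ctx adj k) {x s y c : V}
    {C : Finset V} (hs : adj s x) (hC : C ⊆ (inN adj x).erase s) (hCs : Str adj C)
    (hCd : ∀ c ∈ C, ∀ d ∈ (inN adj x).erase s, d ∉ C → adj c d)
    (hxy : adj x y) (hYs : Str adj ((outN adj x).erase y)) (hc : c ∈ C) (hyc : adj y c)
    {a b : V} (hxa : adj x a) (hay : a ≠ y) (hsa : adj s a) (hxb : adj x b) (hby : b ≠ y)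
    (hbs : adj b s) : Good adj (outN adj x).card := by
  have hyY : y ∈ outN adj x := mem_outN.2 hxy
  have hsY : s ∉ (outN adj x).erase y := by
    simp only [mem_erase, mem_outN, not_and]; exact fun _ h' => h.asym h' hs
  refine ⟨insert s ((outN adj x).erase y), ?_, str_insert hYs (a := a) (b := b) (by simp [mem_outN, *])
    (by simp [mem_outN, *]) hsa hbs, ?_⟩
  · rw [card_insert_of_notMem hsY, card_erase_of_mem hyY]; have := card_pos.2 ⟨y, hyY⟩; omega
  have hmem : ∀ v, v ∈ (insert s ((outN adj x).erase y))ᶜ ↔ v = x ∨ v = y ∨ (v ≠ s ∧ adj v x) := by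
    intro v
    simp only [mem_compl, mem_insert, mem_erase, mem_outN, not_or, not_and]
    rcases h.tri x v with h' | h' | h'
    · subst h'; simp [h.irr, (h.ne hs).symm]
    · have h1 : ¬ adj x v := fun h2 => h.asym h' h2
      have h2 : v ≠ x := h.ne h'
      have h3 : v ≠ y := by rintro rfl; contradiction
      simp [h1, h2, h3, h']
    · have h1 : ¬ adj v x := fun h2 => h.asym h' h2
      have h2 : v ≠ x := (h.ne h').symm
      have h3 : v ≠ s := by rintro rfl; contradiction
      simp [h1, h2, h3, h']
  have hCx : ∀ c ∈ C, c ≠ s ∧ adj c x := by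
    intro c hc; have := hC hc; simpa [mem_inN] using this
  refine str_root x ?_ ?_
  · intro U hU ⟨u, hu⟩ hxU
    by_cases hUS : ∃ s ∈ U, adj s x
    · obtain ⟨s, hs, hsx⟩ := hUS
      exact ⟨s, hs, x, (hmem x).2 (.inl rfl), hxU, hsx⟩
    · push Not at hUS
      have : u = y := by
        have := (hmem u).1 (hU hu)
        rcases this with h' | h' | h'
        · subst h'; contradiction
        · exact h'
        · exact absurd h'.2 (hUS u hu)
      subst this
      exact ⟨u, hu, c, (hmem c).2 (.inr (.inr (hCx c hc))), fun h' => hUS c h' (hCx c hc).2, hyc⟩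
  · intro U hU ⟨u, hu⟩ hxU
    by_cases hyU : y ∈ U
    · exact ⟨y, hyU, x, (hmem x).2 (.inl rfl), hxU, hxy⟩
    have hUS : ∀ u ∈ U, u ≠ s ∧ adj u x := by
      intro v hv
      rcases (hmem v).1 (hU hv) with h' | h' | h'
      · subst h'; contradiction
      · subst h'; contradiction
      · exact h'
    by_cases hcU : c ∈ U
    · exact ⟨c, hcU, y, (hmem y).2 (.inr (.inl rfl)), hyU, hyc⟩
    by_cases hUC' : ∃ c ∈ C, c ∈ U
    · obtain ⟨c', hc', hcU'⟩ := hUC'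
      obtain ⟨a, a1, a2, w, w1, w2, haw⟩ := hCs.flip.cut U hc' hcU' hc hcU
      exact ⟨a, a2, w, (hmem w).2 (.inr (.inr (hCx w w1))), w2, haw⟩
    · push Not at hUC'
      exact ⟨u, hu, c, (hmem c).2 (.inr (.inr (hCx c hc))), hcU, hCd c hc u (by simpa [mem_inN] using hUS u hu) (fun h => hUC' u h hu)⟩

/-- choice of `s`: enough in-degree, not a sink, not a unique in-neighbour -/
theorem choose_s (hT : IsTournament adj) {S S0 : Finset V} (hS0 : S0 ⊆ S) (hc : 4 ≤ S0.card)
    (hsrc : ∀ v ∈ S, ∃ w ∈ S, adj w v) (hS0' : ∀ v ∈ S, v ∉ S0 → ∀ w ∈ S, ¬ adj v w) :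
    ∃ s ∈ S0, (∃ i ∈ S, ∃ j ∈ S, i ≠ j ∧ adj i s ∧ adj j s) ∧
      ∀ z ∈ S, z ≠ s → ∃ w ∈ S, w ≠ s ∧ adj w z := by
  obtain ⟨h1, h2, h3⟩ := hT
  have g1 : ∃ s ∈ S0, ∃ i ∈ S, ∃ j ∈ S, i ≠ j ∧ adj i s ∧ adj j s := by
    obtain ⟨a, ha⟩ : S0.Nonempty := by rw [← card_pos]; omega
    obtain ⟨b, hb, c, hc, d, hd, hbc, hbd, hcd⟩ := two_lt_card.1 (show 2 < (S0.erase a).card by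
      rw [card_erase_of_mem ha]; omega)
    simp only [mem_erase] at hb hc hd
    have e1 := h3 a b hb.1.symm
    have e2 := h3 a c hc.1.symm
    have e3 := h3 a d hd.1.symm
    have e4 := h3 b c hbc
    have e5 := h3 b d hbd
    have e6 := h3 c d hcd
    have m1 := hS0 ha
    have m2 := hS0 hb.2
    have m3 := hS0 hc.2
    have m4 := hS0 hd.2
    by_cases x1 : adj a b <;> by_cases x2 : adj a c <;> by_cases x3 : adj a d <;> grind
  obtain ⟨s, hs, i, hi, j, hj, hij, his, hjs⟩ := g1
  by_cases hz : ∀ z ∈ S, z ≠ s → ∃ w ∈ S, w ≠ s ∧ adj w z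
  · exact ⟨s, hs, ⟨i, hi, j, hj, hij, his, hjs⟩, hz⟩
  push Not at hz
  obtain ⟨z, hzS, hzs, hz2⟩ := hz
  have hzd : ∀ w ∈ S, w ≠ s → w ≠ z → adj z w := fun w hw hws hwz =>
    (h3 z w (Ne.symm hwz)).resolve_right (hz2 w hw hws)
  have : 1 < ((S0.erase s).erase z).card := by
    have := pred_card_le_card_erase (s := S0.erase s) (a := z)
    rw [card_erase_of_mem hs] at this
    omega
  obtain ⟨p, hp, q, hq, hpq⟩ := one_lt_card.1 this
  simp only [mem_erase] at hp hq
  have gen : ∀ w w', w ∈ S0 → w ≠ z → w ≠ s → w' ∈ S → w' ≠ z → adj w' w → 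
     ∃ s ∈ S0, (∃ i ∈ S, ∃ j ∈ S, i ≠ j ∧ adj i s ∧ adj j s) ∧
      ∀ z ∈ S, z ≠ s → ∃ w ∈ S, w ≠ s ∧ adj w z := by
    intro w w' hw hwz hws hw' hwz' hww
    refine ⟨w, hw, ⟨z, hzS, w', hw', hwz'.symm, hzd w (hS0 hw) hws hwz, hww⟩, ?_⟩
    intro t ht htw
    by_cases hts : t = s
    · subst hts
      by_cases hiw : i = w
      · exact ⟨j, hj, by rintro rfl; exact hij hiw, hjs⟩
      · exact ⟨i, hi, hiw, his⟩
    by_cases htz : t = z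
    · subst htz
      obtain ⟨r, hr, hrt⟩ := hsrc t ht
      refine ⟨r, hr, ?_, hrt⟩
      rintro rfl
      exact hz2 r hr hws hrt
    · exact ⟨z, hzS, Ne.symm hwz, hzd t ht hts htz⟩
  rcases h3 p q hpq with h | h
  · exact gen q p hq.2.2 hq.1 hq.2.1 (hS0 hp.2.2) hp.1 h
  · exact gen p q hp.2.2 hp.1 hp.2.1 (hS0 hq.2.2) hq.1 h

theorem caseI_swap {k : ℕ} (h : Ctx adj k) {x : V} (hx : (inN adj x).card = k)
    (hY : Str adj (outN adj x)) (hsrc : ∀ v, adj v x → ∃ w, adj w x ∧ adj w v)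
    {S0 : Finset V} (hS0 : S0 ⊆ inN adj x) (hc : 4 ≤ S0.card)
    (hS0' : ∀ v, adj v x → v ∉ S0 → ∀ w, adj w x → ¬ adj v w)
    (hS0'' : ∀ v ∈ S0, ∃ w, adj w x ∧ adj v w) : Good adj (outN adj x).card := by
  have hT := h.hT
  obtain ⟨s, hs, ⟨i, hi, j, hj, hij, his, hjs⟩, hz⟩ := choose_s hT hS0 hc (by simpa [mem_inN] using hsrc)
    (by simpa [mem_inN] using hS0')
  have hsS := hS0 hs
  have hsx := mem_inN.1 hsS
  have hcS := card_le_card hS0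
  obtain ⟨o, hox, hso⟩ := hS0'' s hs
  have hoS : o ∈ inN adj x := mem_inN.2 hox
  obtain ⟨C, c1, c2, c3, c4⟩ := init_comp hT ((inN adj x).erase s) (by
    rw [← card_pos, card_erase_of_mem hsS]; omega)
  have hC3 : 3 ≤ C.card := by
    have := str_card_ne_two hT c3
    by_contra hcon
    have hc1 : C.card = 1 := by have := c2.card_pos; omega
    obtain ⟨z, rfl⟩ := card_eq_one.1 hc1
    have hzz := c1 (mem_singleton_self z)
    rw [mem_erase] at hzz
    obtain ⟨w, w1, w2, w3⟩ := hz z hzz.2 hzz.1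
    exact h.asym w3 (c4 z (by simp) w (by simp [w1, w2]) (by simp; exact h.ne w3))
  have hdx := h.dout x
  obtain ⟨y, hxy, hYs, c, hcC, hyc⟩ := swap_y h hx hY (c1.trans (erase_subset _ _)) hC3 (by omega)
  have m1 : ∃ a, adj x a ∧ a ≠ y ∧ adj s a := by
    by_contra hcon
    push Not at hcon
    have : outN adj s ⊆ insert x (insert y ((((inN adj x).erase s).erase i).erase j)) := by
      intro w hw
      rw [mem_outN] at hw
      simp only [mem_insert, mem_erase, mem_inN]
      by_cases hwx : w = x
      · exact .inl hwx
      by_cases hwy : w = y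
      · exact .inr (.inl hwy)
      refine .inr (.inr ⟨?_, ?_, (h.ne hw).symm, ?_⟩)
      · rintro rfl; exact h.asym hw hjs
      · rintro rfl; exact h.asym hw his
      · exact h.tot hwx fun hxw => hcon w hxw hwy hw
    have := card_le_card this
    have := h.dout s
    have := card_insert_le x (insert y ((((inN adj x).erase s).erase i).erase j))
    have := card_insert_le y ((((inN adj x).erase s).erase i).erase j)
    rw [card_erase_of_mem (by simp [hj, hij.symm, h.ne hjs]), card_erase_of_mem (by simp [hi, h.ne his]),
      card_erase_of_mem hsS] at this
    omega
  have m2 : ∃ b, adj x b ∧ b ≠ y ∧ adj b s := by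
    by_contra hcon
    push Not at hcon
    have : inN adj s ⊆ insert y (((inN adj x).erase s).erase o) := by
      intro w hw
      rw [mem_inN] at hw
      simp only [mem_insert, mem_erase, mem_inN]
      by_cases hwy : w = y
      · exact .inl hwy
      refine .inr ⟨?_, h.ne hw, ?_⟩
      · rintro rfl; exact h.asym hw hso
      · refine h.tot ?_ fun hxw => hcon w hxw hwy hw
        rintro rfl; exact h.asym hw hsx
    have := card_le_card this
    have := h.din s
    have := card_insert_le y (((inN adj x).erase s).erase o)
    rw [card_erase_of_mem (by simp [hoS, (h.ne hso).symm]), card_erase_of_mem hsS] at this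
    omega
  obtain ⟨a, a1, a2, a3⟩ := m1
  obtain ⟨b, b1, b2, b3⟩ := m2
  exact swap_fin h hsx c1 c3 c4 hxy hYs hcC hyc a1 a2 a3 b1 b2 b3

end TT
end

section
namespace TT
open Classical Finset
variable {adj : V → V → Prop}
set_option linter.unusedSectionVars false
variable [Fintype V]

theorem caseI_k5 {k : ℕ} (h : Ctx adj k) {x : V} (hx : (inN adj x).card = k)
    (hY : Str adj (outN adj x)) (hsrc : ∀ v, adj v x → ∃ w, adj w x ∧ adj w v) (hk : 4 ≤ k)
    (hsk : k = 4 → ∀ v, adj v x → ∃ w, adj w x ∧ adj v w) : Good adj (outN adj x).card := by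
  by_cases hs : ∀ v, adj v x → ∃ w, adj w x ∧ adj v w
  · exact caseI_swap h hx hY hsrc (Subset.refl _) (by omega)
      (fun v hv hv' => absurd (mem_inN.2 hv) hv') (fun v hv => hs v (mem_inN.1 hv))
  · have hk5 : k ≠ 4 := fun hk' => hs (hsk hk')
    push Not at hs
    obtain ⟨t, ht, ht'⟩ := hs
    refine caseI_swap h hx hY hsrc (erase_subset t _) ?_ ?_ ?_
    · rw [card_erase_of_mem (mem_inN.2 ht)]; omega
    · intro v hv hv'
      have : v = t := by
        by_contra hvt
        exact hv' (mem_erase.2 ⟨hvt, mem_inN.2 hv⟩)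
      subst this
      exact ht'
    · intro v hv
      rw [mem_erase, mem_inN] at hv
      exact ⟨t, ht, h.tot hv.1 (ht' v hv.2)⟩

theorem caseI_k4 (h : Ctx adj 4) {x : V} (hx : (inN adj x).card = 4)
    (hY : Str adj (outN adj x)) (hsrc : ∀ v, adj v x → ∃ w, adj w x ∧ adj w v) {t : V}
    (ht : adj t x) (ht' : ∀ w, adj w x → ¬ adj t w) :
    Good adj (outN adj x).card ∨
      ∃ z, (inN adj z).card = 4 ∧ ∀ v, adj v z → ∃ w, adj w z ∧ adj v w := by
  have hT := h.hT
  have htS := mem_inN.2 ht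
  have hSc : ((inN adj x).erase t).card = 3 := by rw [card_erase_of_mem htS]; omega
  obtain ⟨C, c1, c2, c3, c4⟩ := init_comp hT ((inN adj x).erase t) (by
    rw [← card_pos]; omega)
  have hC3 : 3 ≤ C.card := by
    have := str_card_ne_two hT c3
    by_contra hcon
    have hc1 : C.card = 1 := by have := c2.card_pos; omega
    obtain ⟨z, rfl⟩ := card_eq_one.1 hc1
    have hzz := c1 (mem_singleton_self z)
    rw [mem_erase, mem_inN] at hzz
    obtain ⟨w, w2, w3⟩ := hsrc z hzz.2
    refine h.asym w3 (c4 z (by simp) w ?_ (by simp; exact h.ne w3))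
    rw [mem_erase, mem_inN]
    refine ⟨?_, w2⟩
    rintro rfl
    exact ht' _ hzz.2 w3
  have hCe : C = (inN adj x).erase t := eq_of_subset_of_card_le c1 (by omega)
  have hdx := h.dout x
  obtain ⟨y, hxy, hYs, c, hcC, hyc⟩ := swap_y h hx hY (c1.trans (erase_subset _ _)) hC3 (by omega)
  have m1 : ∃ a, adj x a ∧ a ≠ y ∧ adj t a := by
    by_contra hcon
    push Not at hcon
    have : outN adj t ⊆ {x, y} := by
      intro w hw
      rw [mem_outN] at hw
      simp only [mem_insert, mem_singleton]
      by_cases hwx : w = x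
      · exact .inl hwx
      by_cases hwy : w = y
      · exact .inr hwy
      exact absurd hw (ht' w (h.tot hwx fun hxw => hcon w hxw hwy hw))
    have := card_le_card this
    have := h.dout t
    have : ({x, y} : Finset V).card ≤ 2 := card_le_two
    omega
  obtain ⟨a, a1, a2, a3⟩ := m1
  by_cases m2 : ∃ b, adj x b ∧ b ≠ y ∧ adj b t
  · obtain ⟨b, b1, b2, b3⟩ := m2
    exact .inl (swap_fin h ht c1 c3 c4 hxy hYs hcC hyc a1 a2 a3 b1 b2 b3)
  · right
    push Not at m2
    have hsub : inN adj t ⊆ insert y C := by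
      intro w hw
      rw [mem_inN] at hw
      by_cases hwy : w = y
      · simp [hwy]
      refine mem_insert_of_mem ?_
      rw [hCe, mem_erase, mem_inN]
      refine ⟨h.ne hw, h.tot ?_ fun hxw => m2 w hxw hwy hw⟩
      rintro rfl; exact h.asym hw ht
    have h1 := card_le_card hsub
    have h2 := card_insert_le y C
    have h3 := h.din t
    have hC3' : C.card = 3 := by rw [hCe]; exact hSc
    have heq : inN adj t = insert y C := eq_of_subset_of_card_le hsub (by omega)
    refine ⟨t, by rw [heq] at h3 ⊢; omega, ?_⟩
    intro v hv
    have hv := mem_inN.2 hv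
    rw [heq, mem_insert] at hv
    rcases hv with rfl | hv
    · exact ⟨c, mem_inN.1 (by rw [heq]; simp [hcC]), hyc⟩
    · obtain ⟨w, hw, hvw⟩ := c3.out hv (by omega)
      exact ⟨w, mem_inN.1 (by rw [heq]; simp [hw]), hvw⟩

end TT
end

section
namespace TT
open Classical Finset
variable {adj : V → V → Prop}
set_option linter.unusedSectionVars false
variable [Fintype V]

theorem str_4 {a b c d : V} (h1 : adj a b) (h2 : adj b c) (h3 : adj c d) (h4 : adj d a) :
    Str adj {a, b, c, d} := by
  intro U hU ⟨u, hu⟩ hne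
  by_contra hcon
  push Not at hcon
  have k1 : a ∈ U → b ∈ U := fun h => by by_contra h'; exact hcon a h b (by simp) h' h1
  have k2 : b ∈ U → c ∈ U := fun h => by by_contra h'; exact hcon b h c (by simp) h' h2
  have k3 : c ∈ U → d ∈ U := fun h => by by_contra h'; exact hcon c h d (by simp) h' h3
  have k4 : d ∈ U → a ∈ U := fun h => by by_contra h'; exact hcon d h a (by simp) h' h4
  have hu' := hU hu
  simp only [mem_insert, mem_singleton] at hu'
  have : a ∈ U ∧ b ∈ U ∧ c ∈ U ∧ d ∈ U := by
    rcases hu' with rfl | rfl | rfl | rfl <;> tauto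
  apply hne
  refine Subset.antisymm hU ?_
  intro w hw
  simp only [mem_insert, mem_singleton] at hw
  rcases hw with rfl | rfl | rfl | rfl <;> tauto

theorem tri_through (hT : IsTournament adj) {B : Finset V} (h : Str adj B) (hc : B.card = 3)
    {v : V} (hv : v ∈ B) : ∃ a b, adj v a ∧ adj a b ∧ adj b v ∧ B = {v, a, b} := by
  obtain ⟨a, ha, b, hb, h1, h2, h3⟩ := str_triangle_through hT h hv (by omega)
  refine ⟨a, b, h1, h2, h3, ?_⟩
  symm
  apply eq_of_subset_of_card_le
  · intro w; simp only [mem_insert, mem_singleton]; rintro (rfl | rfl | rfl) <;> assumption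
  · have h1' : v ≠ a := by rintro rfl; exact hT.1 _ h1
    have h2' : a ≠ b := by rintro rfl; exact hT.1 _ h2
    have h3' : v ≠ b := by rintro rfl; exact hT.1 _ h3
    rw [card_eq_three.2 ⟨v, a, b, h1', h3', h2', rfl⟩]; omega

theorem sub3 {B : Finset V} (hc : 3 ≤ B.card) {a b c : V}
    (h : ∀ w ∈ B, w = a ∨ w = b ∨ w = c) : a ∈ B ∧ b ∈ B ∧ c ∈ B := by
  have : B = {a, b, c} := by
    apply eq_of_subset_of_card_le
    · intro w hw; simpa using h w hw
    · have := card_le_three (a := a) (b := b) (c := c); omega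
  subst this; simp

theorem sup3 {B : Finset V} (hc : B.card = 3) {a b c : V} (ha : a ∈ B) (hb : b ∈ B) (hc' : c ∈ B)
    (h1 : a ≠ b) (h2 : a ≠ c) (h3 : b ≠ c) {w : V} (hw : w ∈ B) : w = a ∨ w = b ∨ w = c := by
  have : {a, b, c} = B := by
    apply eq_of_subset_of_card_le
    · intro w; simp only [mem_insert, mem_singleton]; rintro (rfl | rfl | rfl) <;> assumption
    · rw [card_eq_three.2 ⟨a, b, c, h1, h2, h3, rfl⟩]; omega
  subst this; simpa using hw

theorem str_of_src (hT : IsTournament adj) {S : Finset V} (hc : S.card = 3)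
    (hsrc : ∀ v ∈ S, ∃ w ∈ S, adj w v) : Str adj S := by
  obtain ⟨C, c1, c2, c3, c4⟩ := init_comp hT S (by rw [← card_pos]; omega)
  have hC3 : 3 ≤ C.card := by
    have := str_card_ne_two hT c3
    by_contra hcon
    have hc1 : C.card = 1 := by have := c2.card_pos; omega
    obtain ⟨z, rfl⟩ := card_eq_one.1 hc1
    obtain ⟨w, w2, w3⟩ := hsrc z (c1 (by simp))
    refine hT.2.1 _ _ w3 (c4 z (by simp) w w2 ?_)
    rw [mem_singleton]; rintro rfl; exact hT.1 _ w3
  rwa [← eq_of_subset_of_card_le c1 (by omega)]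

set_option maxHeartbeats 1000000 in
theorem k3_n8 (h : Ctx adj 3) {x : V} (hx : (inN adj x).card = 3)
    (hY : Str adj (outN adj x)) (hS : Str adj (inN adj x)) (hc : (outN adj x).card = 4) :
    Good adj 4 := by
  have hT := h.hT
  -- find y
  have hy : ∃ y a b c, outN adj x = {y, a, b, c} ∧ adj a b ∧ adj b c ∧ adj c a ∧
      adj y a ∧ adj b y ∧ adj c y := by
    obtain ⟨v0, hv0⟩ : (outN adj x).Nonempty := by rw [← card_pos]; omega
    obtain ⟨B, b1, b2, b3, b4⟩ := grow hT hY hv0 3 (by omega) (by omega)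
    obtain ⟨y, hyY, hyB⟩ : ∃ y ∈ outN adj x, y ∉ B := by
      by_contra hcon; push Not at hcon
      have := card_le_card (show outN adj x ⊆ B from hcon); omega
    have hYB : outN adj x = insert y B := by
      symm; apply eq_of_subset_of_card_le
      · exact insert_subset hyY b1
      · rw [card_insert_of_notMem hyB]; omega
    have hno : ∀ z ∈ B, z ≠ y := by rintro z hz rfl; exact hyB hz
    obtain ⟨i, hi, hiy⟩ := hY.inn hyY (by omega)
    have hiB : i ∈ B := by
      rw [hYB, mem_insert] at hi; rcases hi with rfl | hi
      · exact absurd hiy (h.irr _)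
      · exact hi
    obtain ⟨a, b, i1, i2, i3, hB⟩ := tri_through hT b2 b4 hiB
    have haB : a ∈ B := by rw [hB]; simp
    have hbB : b ∈ B := by rw [hB]; simp
    obtain ⟨o, ho, hyo⟩ := hY.out hyY (by omega)
    have hoB : o = a ∨ o = b := by
      rw [hYB, hB] at ho
      simp only [mem_insert, mem_singleton] at ho
      rcases ho with rfl | rfl | ho
      · exact absurd hyo (h.irr _)
      · exact absurd hyo (fun h' => h.asym h' hiy)
      · exact ho
    -- i → a → b → i, i → y
    by_cases ha : adj y a
    · by_cases hb : adj y b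
      · -- y → a, b ; i → y.  a has out only b. take a; triangle b i y
        refine ⟨a, b, i, y, ?_, i3, hiy, hb, i2, i1, ha⟩
        rw [hYB, hB]; ext w; simp; tauto
      · exact ⟨y, a, b, i, by rw [hYB, hB]; ext w; simp; tauto, i2, i3, i1, ha,
          h.tot (hno b hbB) hb, hiy⟩
    · have hb : adj y b := by rcases hoB with rfl | rfl; exacts [absurd hyo ha, hyo]
      exact ⟨y, b, i, a, by rw [hYB, hB]; ext w; simp; tauto, i3, i1, i2, hb, hiy,
          h.tot (hno a haB) ha⟩
  obtain ⟨y, a, b, c, hYe, hab, hbc, hca, hya, hby, hcy⟩ := hy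
  have hxY : ∀ w, adj x w ↔ w = y ∨ w = a ∨ w = b ∨ w = c := by
    intro w; rw [← mem_outN (adj := adj), hYe]; simp
  have key : ∀ s s' s'', adj s s' → adj s' s'' → adj s'' s → inN adj x = {s, s', s''} → adj y s →
      Good adj 4 ∨ adj s'' y := by
    intro s s' s'' e1 e2 e3 hSe hys
    have hxS : ∀ w, adj w x ↔ w = s ∨ w = s' ∨ w = s'' := by
      intro w; rw [← mem_inN (adj := adj), hSe]; simp
    by_cases m1 : ∃ u ∈ ({a, b, c} : Finset V), adj s'' u
    · by_cases m2 : ∃ u ∈ ({a, b, c} : Finset V), adj u s''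
      · left
        obtain ⟨u, hu, hu'⟩ := m1
        obtain ⟨w, hw, hw'⟩ := m2
        have st := str_insert (str_tri hab hbc hca) hu hw hu' hw'
        have st2 := str_4 ((hxY y).2 (by simp)) hys e1 ((hxS s').2 (by simp))
        have hsc : (({s'', a, b, c} : Finset V)ᶜ) = {x, y, s, s'} := by
          ext v
          have ht := h.tri x v
          rw [hxS, hxY] at ht
          simp only [mem_compl, mem_insert, mem_singleton]
          constructor
          · tauto
          · have q1 : ∀ p q, adj p x → adj x q → p ≠ q := by
              rintro p _ hp hq rfl; exact h.asym hp hq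
            have q2 : ∀ p, adj p x → p ≠ x := fun p hp => h.ne hp
            have q3 : ∀ p, adj x p → p ≠ x := fun p hp => (h.ne hp).symm
            simp only [hxS, hxY] at q1 q2 q3
            have e1' := h.ne e1
            have e2' := h.ne e2
            have e3' := h.ne e3
            have := h.ne hab; have := h.ne hbc; have := h.ne hca
            have := h.ne hya; have := h.ne hby; have := h.ne hcy
            rintro (rfl | rfl | rfl | rfl)
            · have := q2 s'' (by simp); have := q3 a (by simp); have := q3 b (by simp)
              have := q3 c (by simp); grind
            · have := q1 s'' v (by simp) (by simp); grind
            · have := q1 v a (by simp) (by simp); have := q1 v b (by simp) (by simp)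
              have := q1 v c (by simp) (by simp); grind
            · have := q1 v a (by simp) (by simp); have := q1 v b (by simp) (by simp)
              have := q1 v c (by simp) (by simp); grind
        refine ⟨({s'', a, b, c} : Finset V)ᶜ, ?_, ?_, ?_⟩
        · rw [card_compl]
          have hd := h.deg x
          rw [hx, hc] at hd
          have : ({s'', a, b, c} : Finset V).card = 4 := by
            have q1 : ∀ q, adj x q → s'' ≠ q := by
              rintro _ hq rfl; exact h.asym hq ((hxS _).2 (by simp))
            have := q1 a ((hxY _).2 (by simp)); have := q1 b ((hxY _).2 (by simp))
            have := q1 c ((hxY _).2 (by simp))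
            have := h.ne hab; have := h.ne hbc; have := h.ne hca
            rw [card_insert_of_notMem (by simp; tauto), card_eq_three.2 ⟨a, b, c, by tauto, by tauto, by tauto, rfl⟩]
          omega
        · rw [hsc]; exact st2
        · rw [compl_compl]; exact st
      · exfalso
        push Not at m2
        have := h.din s''
        have hsub : inN adj s'' ⊆ {s', y} := by
          intro w hw
          rw [mem_inN] at hw
          have ht := h.tri x w
          rw [hxS, hxY] at ht
          simp only [mem_insert, mem_singleton] at m2 ⊢
          rcases ht with rfl | (rfl | rfl | rfl) | (rfl | rfl | rfl | rfl)
          · exact absurd ((hxS s'').2 (by simp)) (fun h' => h.asym h' hw)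
          · exact absurd hw (fun h' => h.asym h' e3)
          · simp
          · exact absurd hw (h.irr _)
          · simp
          all_goals exact absurd hw (m2 _ (by simp))
        have := card_le_card hsub
        have : ({s', y} : Finset V).card ≤ 2 := card_le_two
        omega
    · right
      push Not at m1
      have := (sub3 (h.dout s'') (a := x) (b := s) (c := y) (fun w hw => by
        rw [mem_outN] at hw
        have ht := h.tri x w
        rw [hxS, hxY] at ht
        simp only [mem_insert, mem_singleton] at m1
        rcases ht with rfl | (rfl | rfl | rfl) | (rfl | rfl | rfl | rfl)
        · simp
        · simp
        · exact absurd hw (fun h' => h.asym h' e2)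
        · exact absurd hw (h.irr _)
        · simp
        all_goals exact absurd hw (m1 _ (by simp)))).2.2
      exact mem_outN.1 this
  obtain ⟨s, hs⟩ : (inN adj x).Nonempty := by rw [← card_pos]; omega
  obtain ⟨s', s'', e1, e2, e3, hSe⟩ := tri_through hT hS hx hs
  have two : ∀ p q, adj p x → adj q x → adj p y → adj q y → p = q := by
    intro p q hp hq hpy hqy
    by_contra hpq
    have hsub : outN adj y ⊆ insert a (((inN adj x).erase p).erase q) := by
      intro w hw
      rw [mem_outN] at hw
      rcases h.tri x w with rfl | hwx | hwx
      · exact absurd hw (fun h' => h.asym h' ((hxY y).2 (by simp)))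
      · refine mem_insert_of_mem ?_
        simp only [mem_erase, mem_inN]
        refine ⟨?_, ?_, hwx⟩
        · rintro rfl; exact h.asym hw hqy
        · rintro rfl; exact h.asym hw hpy
      · rcases (hxY w).1 hwx with rfl | rfl | rfl | rfl
        · exact absurd hw (h.irr _)
        · simp
        · exact absurd hw (fun h' => h.asym h' hby)
        · exact absurd hw (fun h' => h.asym h' hcy)
    have := card_le_card hsub
    have := card_insert_le a (((inN adj x).erase p).erase q)
    rw [card_erase_of_mem (by simp [mem_inN, hq]; tauto), card_erase_of_mem (mem_inN.2 hp)] at this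
    have := h.dout y
    omega
  have hxS : ∀ w, adj w x ↔ w = s ∨ w = s' ∨ w = s'' := by
    intro w; rw [← mem_inN (adj := adj), hSe]; simp
  by_contra hG
  have k1 := key s s' s'' e1 e2 e3 hSe
  have k2 := key s' s'' s e2 e3 e1 (by rw [hSe]; ext; simp; tauto)
  have k3 := key s'' s s' e3 e1 e2 (by rw [hSe]; ext; simp; tauto)
  have ty : ∀ p, adj p x → adj y p ∨ adj p y := by
    intro p hp
    by_contra hcon; push Not at hcon
    refine hcon.1 (h.tot ?_ hcon.2)
    rintro rfl; exact h.asym hp ((hxY _).2 (by simp))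
  have x0 := (hxS s).2 (by simp)
  have x1 := (hxS s').2 (by simp)
  have x2 := (hxS s'').2 (by simp)
  have t1 := ty s x0
  have t2 := ty s' x1
  have t3 := ty s'' x2
  have w1 := two s s' x0 x1
  have w2 := two s s'' x0 x2
  have w3 := two s' s'' x1 x2
  have := h.ne e1; have := h.ne e2; have := (h.ne e3).symm
  have a1 := fun h1 h2 => h.asym (u := y) (v := s) h1 h2
  have a2 := fun h1 h2 => h.asym (u := y) (v := s') h1 h2
  have a3 := fun h1 h2 => h.asym (u := y) (v := s'') h1 h2
  simp only [hG, false_or] at k1 k2 k3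
  rcases t1 with t1 | t1 <;> rcases t2 with t2 | t2 <;> rcases t3 with t3 | t3 <;> grind

end TT
end

section
namespace TT
open Classical Finset
variable {adj : V → V → Prop}
set_option linter.unusedSectionVars false
variable [Fintype V]

theorem no_quad (h : Ctx adj 3) {v a b c : V} (hc : (outN adj v).card = 3)
    (h1 : adj v a) (h2 : adj v b) (h3 : adj v c) (e1 : adj a b) (e2 : adj b c) (e3 : adj c a)
    {p q r : V} (k1 : adj v p) (k2 : adj v q) (k3 : adj v r) (m1 : adj p q) (m2 : adj p r)
    (m3 : adj q r) : False := by
  have := fun {w} (hw : adj v w) => sup3 hc (mem_outN.2 h1) (mem_outN.2 h2) (mem_outN.2 h3) (h.ne e1)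
    (h.ne e3).symm (h.ne e2) (mem_outN.2 hw)
  have i1 := h.irr a; have i2 := h.irr b; have i3 := h.irr c
  have a1 := fun h' => h.asym e1 h'
  have a2 := fun h' => h.asym e2 h'
  have a3 := fun h' => h.asym e3 h'
  rcases this k1 with rfl | rfl | rfl <;> rcases this k2 with rfl | rfl | rfl <;>
    rcases this k3 with rfl | rfl | rfl <;> contradiction

theorem k3_n7 (h : Ctx adj 3) {x : V} (hx : (inN adj x).card = 3)
    (hY : Str adj (outN adj x)) (hS : Str adj (inN adj x)) (hc : (outN adj x).card = 3)
    (hexc : ∃ a b c d, adj a b ∧ adj a c ∧ adj a d ∧ adj b c ∧ adj b d ∧ adj c d) :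
    Good adj 3 := by
  have hT := h.hT
  have hn : Fintype.card V = 7 := by have := h.deg x; omega
  have do3 : ∀ v, (outN adj v).card = 3 := by
    intro v; have := h.deg v; have := h.dout v; have := h.din v; omega
  have di3 : ∀ v, (inN adj v).card = 3 := by
    intro v; have := h.deg v; have := h.dout v; have := h.din v; omega
  obtain ⟨s0, hs0⟩ : (inN adj x).Nonempty := by rw [← card_pos]; omega
  obtain ⟨s1, s2, e1, e2, e3, hSe⟩ := tri_through hT hS hx hs0
  have hxS : ∀ w, adj w x ↔ w = s0 ∨ w = s1 ∨ w = s2 := by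
    intro w; rw [← mem_inN (adj := adj), hSe]; simp
  obtain ⟨p, hp, hp1⟩ : ∃ p, adj s0 p ∧ p ≠ x ∧ p ≠ s1 := by
    by_contra hcon
    push Not at hcon
    have hsub : outN adj s0 ⊆ {x, s1} := by
      intro w hw
      rw [mem_outN] at hw
      simp only [mem_insert, mem_singleton]
      by_cases hwx : w = x
      · exact .inl hwx
      · exact .inr (hcon w hw hwx)
    have := card_le_card hsub
    have := do3 s0
    have : ({x, s1} : Finset V).card ≤ 2 := card_le_two
    omega
  have s0x := (hxS s0).2 (by simp)
  have s1x := (hxS s1).2 (by simp)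
  have s2x := (hxS s2).2 (by simp)
  have xp : adj x p := by
    refine h.tot hp1.1.symm ?_
    rw [hxS]
    rintro (rfl | rfl | rfl)
    · exact h.irr _ hp
    · exact hp1.2 rfl
    · exact h.asym hp e3
  obtain ⟨q, r, pq, qr, rp, hYe⟩ := tri_through hT hY hc (mem_outN.2 xp)
  have hxY : ∀ w, adj x w ↔ w = p ∨ w = q ∨ w = r := by
    intro w; rw [← mem_outN (adj := adj), hYe]; simp
  have xq := (hxY q).2 (by simp)
  have xr := (hxY r).2 (by simp)
  have sy : ∀ s y, adj s x → adj x y → s ≠ y := by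
    rintro s _ hs hy rfl; exact h.asym hs hy
  have all : ∀ w, w = x ∨ w = s0 ∨ w = s1 ∨ w = s2 ∨ w = p ∨ w = q ∨ w = r := by
    intro w
    have := h.tri x w
    rw [hxS, hxY] at this
    tauto
  have o_s0 : ∀ {w}, adj s0 w → w = x ∨ w = s1 ∨ w = p := fun hw =>
    sup3 (do3 s0) (mem_outN.2 s0x) (mem_outN.2 e1) (mem_outN.2 hp) (h.ne s1x).symm (h.ne xp)
      (sy _ _ s1x xp) (mem_outN.2 hw)
  have qs0 : adj q s0 := by
    refine h.tot (sy _ _ s0x xq).symm fun hw => ?_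
    rcases o_s0 hw with rfl | rfl | rfl
    exacts [h.irr _ xq, sy _ _ s1x xq rfl, h.irr _ pq]
  have rs0 : adj r s0 := by
    refine h.tot (sy _ _ s0x xr).symm fun hw => ?_
    rcases o_s0 hw with rfl | rfl | rfl
    exacts [h.irr _ xr, sy _ _ s1x xr rfl, h.irr _ rp]
  have o_p := sub3 (h.dout p) (a := q) (b := s1) (c := s2) (fun w hw => by
    rw [mem_outN] at hw
    rcases all w with rfl | rfl | rfl | rfl | rfl | rfl | rfl
    · exact absurd hw fun h' => h.asym h' xp
    · exact absurd hw fun h' => h.asym h' hp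
    · simp
    · simp
    · exact absurd hw (h.irr _)
    · simp
    · exact absurd hw fun h' => h.asym h' rp)
  simp only [mem_outN] at o_p
  obtain ⟨-, ps1, ps2⟩ := o_p
  by_cases s2r : adj s2 r
  · refine ⟨{x, q, s0}, ?_, str_tri xq qs0 s0x, ?_⟩
    · exact card_eq_three.2 ⟨x, q, s0, h.ne xq, (h.ne s0x).symm, h.ne qs0, rfl⟩
    · have : ({x, q, s0} : Finset V)ᶜ = {s1, s2, r, p} := by
        ext w
        simp only [mem_compl, mem_insert, mem_singleton]
        constructor
        · intro hw; have := all w; tauto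
        · rintro (rfl | rfl | rfl | rfl) <;> push Not
          · exact ⟨h.ne s1x, sy _ _ s1x xq, (h.ne e1).symm⟩
          · exact ⟨h.ne s2x, sy _ _ s2x xq, (h.ne e3)⟩
          · exact ⟨(h.ne xr).symm, (h.ne qr).symm, h.ne rs0⟩
          · exact ⟨(h.ne xp).symm, h.ne pq, (h.ne hp).symm⟩
      rw [this]
      exact str_4 e2 s2r rp ps1
  · exfalso
    have rs2 : adj r s2 := h.tot (sy _ _ s2x xr).symm s2r
    have s1r : adj s1 r := by
      refine h.tot (sy _ _ s1x xr) fun hw => ?_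
      rcases sup3 (do3 r) (mem_outN.2 rp) (mem_outN.2 rs0) (mem_outN.2 rs2) (h.ne hp).symm
        (h.ne ps2) (h.ne e3).symm (mem_outN.2 hw) with h' | h' | h'
      · exact sy _ _ s1x xp h'
      · exact h.ne e1 h'.symm
      · exact h.ne e2 h'
    have s2q : adj s2 q := by
      have := sub3 (h.dout s2) (a := x) (b := s0) (c := q) (fun w hw => by
        rw [mem_outN] at hw
        rcases all w with rfl | rfl | rfl | rfl | rfl | rfl | rfl
        · simp
        · simp
        · exact absurd hw fun h' => h.asym h' e2
        · exact absurd hw (h.irr _)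
        · exact absurd hw fun h' => h.asym h' ps2
        · simp
        · exact absurd hw fun h' => h.asym h' rs2)
      exact mem_outN.1 this.2.2
    have qs1 : adj q s1 := by
      refine h.tot (sy _ _ s1x xq).symm fun hw => ?_
      rcases sup3 (do3 s1) (mem_outN.2 s1x) (mem_outN.2 e2) (mem_outN.2 s1r) (h.ne s2x).symm
        (h.ne xr) (h.ne rs2).symm (mem_outN.2 hw) with h' | h' | h'
      · exact h.ne xq h'.symm
      · exact sy _ _ s2x xq h'.symm
      · exact h.ne qr h'
    obtain ⟨a, b, c, d, ab, ac, ad, bc, bd, cd⟩ := hexc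
    rcases all a with rfl | rfl | rfl | rfl | rfl | rfl | rfl
    · exact no_quad h (do3 _) xp xq xr pq qr rp ab ac ad bc bd cd
    · exact no_quad h (do3 _) s0x hp e1 xp ps1 s1x ab ac ad bc bd cd
    · exact no_quad h (do3 _) s1x s1r e2 xr rs2 s2x ab ac ad bc bd cd
    · exact no_quad h (do3 _) s2x s2q e3 xq qs0 s0x ab ac ad bc bd cd
    · exact no_quad h (do3 _) pq ps1 ps2 qs1 e2 s2q ab ac ad bc bd cd
    · exact no_quad h (do3 _) qr qs0 qs1 rs0 e1 s1r ab ac ad bc bd cd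
    · exact no_quad h (do3 _) rp rs2 rs0 ps2 e3 hp ab ac ad bc bd cd

/-- Case I, initial component of size at least 3. -/
theorem caseI_C3 {k : ℕ} (h : Ctx adj k) {x : V} (hx : (inN adj x).card = k)
    (hY : Str adj (outN adj x)) {C : Finset V} (hC : C ⊆ inN adj x) (hCs : Str adj C)
    (hCd : ∀ c ∈ C, ∀ d ∈ inN adj x, d ∉ C → adj c d) (hC3 : 3 ≤ C.card)
    {L : ℕ} (hL : 3 ≤ L) (hLn : 2 * L ≤ Fintype.card V)
    (hexc : Fintype.card V = 7 → ∃ a b c d, adj a b ∧ adj a c ∧ adj a d ∧ adj b c ∧ adj b d ∧ adj c d) :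
    Good adj L ∨ (k = 4 ∧ (¬ ∀ v, adj v x → ∃ w, adj w x ∧ adj v w) ∧
      ∃ z, (inN adj z).card = 4 ∧ ∀ v, adj v z → ∃ w, adj w z ∧ adj v w) := by
  have hd := h.deg x
  have hdo := h.dout x
  by_cases hLY : L + 1 ≤ (outN adj x).card
  · exact .inl (caseI_big h hx hY hC hCs hCd hC3 hL hLY)
  have hLe : L = (outN adj x).card := by omega
  have hsrc : ∀ v, adj v x → ∃ w, adj w x ∧ adj w v := by
    intro v hv
    by_cases hvC : v ∈ C
    · obtain ⟨w, hw, hwv⟩ := hCs.inn hvC (by omega)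
      exact ⟨w, mem_inN.1 (hC hw), hwv⟩
    · obtain ⟨c, hc⟩ : C.Nonempty := by rw [← card_pos]; omega
      exact ⟨c, mem_inN.1 (hC hc), hCd c hc v (mem_inN.2 hv) hvC⟩
  have hk3 := card_le_card hC
  rcases Nat.lt_or_ge k 4 with hk | hk
  · have hk3 : k = 3 := by omega
    subst hk3
    have hCe : C = inN adj x := eq_of_subset_of_card_le hC (by omega)
    subst hCe
    left
    have h34 : (outN adj x).card = 3 ∨ (outN adj x).card = 4 := by omega
    rcases h34 with h3 | h4
    · rw [hLe, h3]; exact k3_n7 h hx hY hCs h3 (hexc (by omega))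
    · rw [hLe, h4]; exact k3_n8 h hx hY hCs h4
  · by_cases hsk : k = 4 → ∀ v, adj v x → ∃ w, adj w x ∧ adj v w
    · left; rw [hLe]; exact caseI_k5 h hx hY hsrc hk hsk
    · obtain ⟨hk4, hsk2⟩ := Classical.not_imp.1 hsk
      subst hk4
      have hsk' := hsk2
      push Not at hsk'
      obtain ⟨t, ht, ht'⟩ := hsk'
      rw [hLe]
      rcases caseI_k4 h hx hY hsrc ht ht' with h' | h'
      · exact .inl h'
      · exact .inr ⟨rfl, hsk2, h'⟩

end TT
end

section
namespace TT
open Classical Finset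
variable {adj : V → V → Prop}
set_option linter.unusedSectionVars false
variable [Fintype V]

theorem c1_fin {k : ℕ} (h : Ctx adj k) {x s b : V} (hsx : adj s x)
    (hs : ∀ w, adj w x → w ≠ s → adj s w) (hxb : adj x b) (hbs : adj b s)
    (hB : Str adj ((({x, s} : Finset V)ᶜ).erase b)) {L : ℕ} (hL : 3 ≤ L)
    (hLn : L + 3 ≤ Fintype.card V) : Good adj L := by
  have hT := h.hT
  have hk := h.hk
  have h2 := h.two (D := ∅) (by simp; omega)
  rw [compl_empty] at h2
  have hcard : ((({x, s} : Finset V)ᶜ).erase b).card = Fintype.card V - 3 := by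
    rw [card_erase_of_mem (by simp [h.ne hbs, (h.ne hxb).symm]), card_compl,
      card_pair (h.ne hsx).symm]
    omega
  obtain ⟨B, b1, b2, b3, b4⟩ := shrink hT h2 hB (subset_univ _) (by
    intro h'
    have : b ∈ (univ : Finset V) := mem_univ b
    rw [← h'] at this; simp at this) L hL (by omega)
  have hmem : ∀ w ∈ B, w ≠ b ∧ w ≠ x ∧ w ≠ s := by
    intro w hw
    have := b1 hw
    simpa using this
  refine ⟨B, b2, b3, ?_⟩
  have xB : x ∈ Bᶜ := by rw [mem_compl]; intro h'; exact (hmem x h').2.1 rfl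
  have sB : s ∈ Bᶜ := by rw [mem_compl]; intro h'; exact (hmem s h').2.2 rfl
  have bB : b ∈ Bᶜ := by rw [mem_compl]; intro h'; exact (hmem b h').1 rfl
  refine str_root x ?_ ?_
  · intro U hU hne hxU
    by_cases hsU : s ∈ U
    · exact ⟨s, hsU, x, xB, hxU, hsx⟩
    by_cases hbU : b ∈ U
    · exact ⟨b, hbU, s, sB, hsU, hbs⟩
    obtain ⟨u, hu, a, -, ha1, ha2, ha3⟩ := b4 U (by
      intro u hu
      have h1 := hU hu
      rw [mem_compl] at h1
      simp only [mem_sdiff, mem_erase, mem_compl, mem_insert, mem_singleton, not_or]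
      refine ⟨⟨?_, ?_, ?_⟩, h1⟩
      all_goals rintro rfl; contradiction) hne
    exact ⟨u, hu, a, mem_compl.2 ha1, ha2, ha3⟩
  · intro U hU ⟨u, hu⟩ hxU
    by_cases hUx : ∃ u ∈ U, adj x u
    · obtain ⟨u, hu, hxu⟩ := hUx
      exact ⟨u, hu, x, xB, hxU, hxu⟩
    push Not at hUx
    by_cases hsU : s ∈ U
    · exact ⟨s, hsU, b, bB, fun h' => hUx b h' hxb, hbs⟩
    · refine ⟨u, hu, s, sB, hsU, hs u (h.tot ?_ (hUx u hu)) ?_⟩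
      · rintro rfl; contradiction
      · rintro rfl; contradiction

theorem erase_eq3 {x s b : V} : (({x, s} : Finset V)ᶜ).erase b = ({x, s, b} : Finset V)ᶜ := by
  ext w; simp; tauto

theorem J_out {k : ℕ} (h : Ctx adj k) {x s b : V} (hsx : adj s x)
    (hs : ∀ w, adj w x → w ≠ s → adj s w) (hbs : adj b s) : adj x b := by
  refine h.tot ?_ ?_
  · rintro rfl; exact h.asym hsx hbs
  · intro h'; exact h.asym hbs (hs b h' (h.ne hbs))

theorem c1_k3 (h : Ctx adj 3) {x s : V} (hsx : adj s x)
    (hs : ∀ w, adj w x → w ≠ s → adj s w) {L : ℕ} (hL : 3 ≤ L)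
    (hLn : L + 3 ≤ Fintype.card V) : Good adj L := by
  by_contra hG
  have key : ∀ b, adj b s → ∃ z, adj x z ∧ adj s z ∧ adj b z ∧ ∀ w, adj w z → w = x ∨ w = s ∨ w = b := by
    intro b hbs
    have hxb := J_out h hsx hs hbs
    have hB : ¬ Str adj ({x, s, b} : Finset V)ᶜ := by
      intro hB; rw [← erase_eq3] at hB
      exact hG (c1_fin h hsx hs hxb hbs hB hL hLn)
    obtain ⟨E, e1, e2, ⟨q, q1, q2⟩, e4⟩ := not_str hB
    have hER : ∀ e ∈ E, e ∉ ({x, s, b} : Finset V) := fun e he => mem_compl.1 (e1 he)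
    have hcl : ∀ e ∈ E, ∀ w, adj e w → w ∈ E ∨ w ∈ ({x, s, b} : Finset V) := by
      intro e he w hw
      by_cases hwR : w ∈ ({x, s, b} : Finset V)
      · exact .inr hwR
      · exact .inl (e4 e he w (mem_compl.2 hwR) hw)
    rcases h.NT {x, s, b} E (card_eq_three.2 ⟨x, s, b, (h.ne hsx).symm, h.ne hxb, (h.ne hbs).symm, rfl⟩)
      e2 (disjoint_left.2 hER) hcl with h1 | h1
    · exfalso
      obtain ⟨z, hz⟩ := card_eq_one.1 (show E.card = 1 by have := e2.card_pos; omega)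
      subst hz
      have hzR := hER z (by simp)
      have := sub3 (h.dout z) (a := x) (b := s) (c := b) (fun w hw => by
        rcases hcl z (by simp) w (mem_outN.1 hw) with h' | h'
        · rw [mem_singleton] at h'; subst h'; exact absurd (mem_outN.1 hw) (h.irr _)
        · simpa using h')
      simp only [mem_outN] at this
      simp at hzR
      exact h.asym this.2.1 (hs z this.1 hzR.2.1)
    · have hqm : q ∈ (({x, s, b} : Finset V) ∪ E)ᶜ := by
        rw [mem_compl, mem_union, not_or]; exact ⟨mem_compl.1 q1, q2⟩
      have hin : ∀ w, adj w q → w = x ∨ w = s ∨ w = b := by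
        intro w hw
        by_cases hwE : w ∈ E
        · exact absurd (hcl w hwE q hw) (by rw [not_or]; exact ⟨q2, mem_compl.1 q1⟩)
        by_cases hwR : w ∈ ({x, s, b} : Finset V)
        · simpa using hwR
        · exact absurd (card_le_one.1 h1 w (by
            rw [mem_compl, mem_union, not_or]; exact ⟨hwR, hwE⟩) q hqm) (h.ne hw)
      have := sub3 (h.din q) (a := x) (b := s) (c := b) (fun w hw => hin w (mem_inN.1 hw))
      simp only [mem_inN] at this
      exact ⟨q, this.1, this.2.1, this.2.2, hin⟩
  have hd := h.din s
  obtain ⟨b, hb, b', hb', hbb⟩ := one_lt_card.1 (show 1 < (inN adj s).card by omega)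
  rw [mem_inN] at hb hb'
  obtain ⟨z, z1, z2, z3, z4⟩ := key b hb
  obtain ⟨z', z1', z2', z3', z4'⟩ := key b' hb'
  have hxb' := J_out h hsx hs hb'
  have hxb := J_out h hsx hs hb
  have hne : z ≠ z' := by
    rintro rfl
    rcases z4 b' z3' with h' | h' | h'
    exacts [h.ne hxb' h'.symm, h.ne hb' h', hbb h'.symm]
  by_cases hz : adj z z'
  · rcases z4' z hz with h' | h' | h'
    · exact h.ne z1 h'.symm
    · exact h.ne z2 h'.symm
    · subst h'; exact h.asym z2 hb'
  · rcases z4 z' (h.tot hne.symm hz) with h' | h' | h'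
    · exact h.ne z1' h'.symm
    · exact h.ne z2' h'.symm
    · subst h'; exact h.asym z2' hb

theorem c1_k4 {k : ℕ} (h : Ctx adj k) (hk : 4 ≤ k) {x s : V} (hsx : adj s x)
    (hs : ∀ w, adj w x → w ≠ s → adj s w) {L : ℕ} (hL : 3 ≤ L)
    (hLn : L + 3 ≤ Fintype.card V) : Good adj L := by
  have hd := h.din s
  obtain ⟨b, hb⟩ : (inN adj s).Nonempty := by rw [← card_pos]; omega
  rw [mem_inN] at hb
  refine c1_fin h hsx hs (J_out h hsx hs hb) hb ?_ hL hLn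
  rw [erase_eq3]
  have := card_le_three (a := x) (b := s) (c := b)
  exact h.K _ (by omega)

theorem claim1 (h : Ctx adj 2) {J : Finset V} {c : V} (hc : c ∉ J) (hJ : J.Nonempty)
    (H : ∀ b ∈ J, ∃ e ∈ J, adj e b ∧ ∀ w, adj e w → w = b ∨ w = c) {q : V} (hq : q ∉ J)
    (hqc : q ≠ c) : False := by
  choose! g hg using H
  have hinj : Set.InjOn g (J : Set V) := by
    intro b hb b' hb' he
    have h1 := hg b hb
    have h2 := hg b' hb'
    rcases h1.2.2 b' (by rw [he]; exact h2.2.1) with h' | h'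
    · exact h'.symm
    · subst h'; exact absurd hb' hc
  have him : J.image g = J := by
    apply eq_of_subset_of_card_le
    · intro w hw
      obtain ⟨b, hb, rfl⟩ := mem_image.1 hw
      exact (hg b hb).1
    · rw [card_image_of_injOn hinj]
  obtain ⟨j, hj⟩ := hJ
  refine (h.K {c} (by simp)).closed J ?_ (a := j) (b := q) ?_ hj ?_ hq
  · intro u hu _ w hw huw
    rw [← him] at hu
    obtain ⟨b, hb, rfl⟩ := mem_image.1 hu
    rcases (hg b hb).2.2 w huw with rfl | rfl
    · exact hb
    · simp at hw
  · simp; rintro rfl; exact hc hj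
  · simp [hqc]

end TT
end

section
namespace TT
open Classical Finset
variable {adj : V → V → Prop}
set_option linter.unusedSectionVars false
variable [Fintype V]

theorem sub2 {B : Finset V} (hc : 2 ≤ B.card) {a b : V}
    (h : ∀ w ∈ B, w = a ∨ w = b) : a ∈ B ∧ b ∈ B := by
  have : B = {a, b} := by
    apply eq_of_subset_of_card_le
    · intro w hw; simpa using h w hw
    · have := card_le_two (a := a) (b := b); omega
  subst this; simp

structure K2 (adj : V → V → Prop) (x s t : V) : Prop where
  h : Ctx adj 2
  hx : ∀ w, adj w x ↔ w = s ∨ w = t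
  st : adj s t
  hY : Str adj (outN adj x)

variable {x s t : V}

theorem K2.sx (g : K2 adj x s t) : adj s x := (g.hx s).2 (by simp)
theorem K2.tx (g : K2 adj x s t) : adj t x := (g.hx t).2 (by simp)
theorem K2.hs (g : K2 adj x s t) : ∀ w, adj w x → w ≠ s → adj s w := by
  intro w hw hws
  rcases (g.hx w).1 hw with rfl | rfl
  · exact absurd rfl hws
  · exact g.st
theorem K2.all (g : K2 adj x s t) (w : V) : w = x ∨ w = s ∨ w = t ∨ adj x w := by
  have := g.h.tri x w
  rw [g.hx] at this
  tauto
theorem K2.J (g : K2 adj x s t) {b : V} (hb : adj b s) : adj x b := J_out g.h g.sx g.hs hb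
theorem K2.Jt (g : K2 adj x s t) {b : V} (hb : adj b s) : b ≠ t := by
  rintro rfl; exact g.h.asym hb g.st
theorem K2.memZ (g : K2 adj x s t) {w : V} : w ∈ (({x, s} : Finset V)ᶜ) ↔ w = t ∨ adj x w := by
  simp only [mem_compl, mem_insert, mem_singleton, not_or]
  constructor
  · intro hw; have := g.all w; tauto
  · rintro (rfl | hw)
    · exact ⟨g.h.ne g.tx, (g.h.ne g.st).symm⟩
    · refine ⟨(g.h.ne hw).symm, ?_⟩
      rintro rfl; exact g.h.asym hw g.sx

theorem K2.strZ (g : K2 adj x s t) : Str adj (({x, s} : Finset V)ᶜ) := by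
  have : (({x, s} : Finset V)ᶜ) = insert t (outN adj x) := by
    ext w; rw [g.memZ, mem_insert, mem_outN]
  rw [this]
  have h := g.h
  have m1 : ∃ a ∈ outN adj x, adj t a := by
    by_contra hcon
    push Not at hcon
    have := (sub2 (h.dout t) (a := x) (b := x) (fun w hw => by
      rw [mem_outN] at hw
      rcases g.all w with rfl | rfl | rfl | h'
      · simp
      · exact absurd hw (fun h' => h.asym h' g.st)
      · exact absurd hw (h.irr _)
      · exact absurd hw (hcon w (mem_outN.2 h'))))
    have h2 : outN adj t ⊆ {x} := fun w hw => by
      rw [mem_outN] at hw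
      rcases g.all w with rfl | rfl | rfl | h'
      · simp
      · exact absurd hw (fun h' => h.asym h' g.st)
      · exact absurd hw (h.irr _)
      · exact absurd hw (hcon w (mem_outN.2 h'))
    have h3 := card_le_card h2
    have := h.dout t
    simp at h3; omega
  have m2 : ∃ a ∈ outN adj x, adj a t := by
    by_contra hcon
    push Not at hcon
    have h2 : inN adj t ⊆ {s} := fun w hw => by
      rw [mem_inN] at hw
      rcases g.all w with rfl | rfl | rfl | h'
      · exact absurd hw (fun h' => h.asym h' g.tx)
      · simp
      · exact absurd hw (h.irr _)
      · exact absurd hw (hcon w (mem_outN.2 h'))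
    have h3 := card_le_card h2
    have := h.din t
    simp at h3; omega
  obtain ⟨a, a1, a2⟩ := m1
  obtain ⟨b, b1, b2⟩ := m2
  exact str_insert g.hY a1 b1 a2 b2

theorem K2.cardZ (g : K2 adj x s t) : ((({x, s} : Finset V)ᶜ)).card = Fintype.card V - 2 := by
  rw [card_compl, card_pair (g.h.ne g.sx).symm]

/-- No vertex of `Y` is dominated by `s`. -/
theorem K2.caseO (g : K2 adj x s t) (hO : ∀ w, adj x w → adj w s) {L : ℕ} (hL : 3 ≤ L)
    (hLn : L + 3 ≤ Fintype.card V) : Good adj L := by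
  obtain ⟨B, b1, b2, b3, b4⟩ := grow g.h.hT g.strZ (g.memZ.2 (.inl rfl)) L hL (by
    rw [g.cardZ]; omega)
  refine ⟨B, b4, b2, ?_⟩
  obtain ⟨y, hy, hyB⟩ : ∃ y ∈ (({x, s} : Finset V)ᶜ), y ∉ B := by
    by_contra hcon; push Not at hcon
    have := card_le_card (show (({x, s} : Finset V)ᶜ) ⊆ B from hcon)
    rw [g.cardZ] at this; omega
  have hyt : y ≠ t := by rintro rfl; contradiction
  have hxy : adj x y := by rcases g.memZ.1 hy with h' | h'; exacts [absurd h' hyt, h']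
  refine str_xy (x := s) (y := x) (s := y) ?_ ?_ (mem_compl.2 hyB) g.sx hxy (hO y hxy) ?_
  · rw [mem_compl]; intro h'; have := b1 h'; simp at this
  · rw [mem_compl]; intro h'; have := b1 h'; simp at this
  · intro v hv
    rcases g.all v with rfl | rfl | rfl | h'
    · simp
    · simp
    · exact absurd b3 (mem_compl.1 hv)
    · exact .inr (.inr (.inr ⟨h', hO v h'⟩))

theorem K2.typeA (g : K2 adj x s t) {b : V} (hb : adj b s) {E : Finset V}
    (hE : Trap adj (({x, s} : Finset V)ᶜ) b E) (ht : t ∉ E) :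
    ∃ e, E = {e} ∧ adj e b ∧ adj e s ∧ adj x e ∧ ∀ w, adj e w → w = b ∨ w = s := by
  obtain ⟨e1, e2, e3, e4, -, e6⟩ := hE
  have h := g.h
  have hsE : s ∉ E := fun h' => by have := e2 h'; simp at this
  have hxE : x ∉ E := fun h' => by have := e2 h'; simp at this
  have hcl : ∀ e ∈ E, ∀ w, adj e w → w ∈ E ∨ w ∈ ({b, s} : Finset V) := by
    intro e he w hw
    by_cases hwZ : w ∈ (({x, s} : Finset V)ᶜ)
    · rcases e6 e he w hwZ hw with h' | h'
      · exact .inl h'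
      · right; simp [h']
    · simp only [mem_compl, mem_insert, mem_singleton, not_not] at hwZ
      rcases hwZ with rfl | rfl
      · rcases (g.hx e).1 hw with rfl | rfl <;> contradiction
      · right; simp
  have hbt := g.Jt hb
  have hxb := g.J hb
  rcases h.NT {b, s} E (card_pair (h.ne hb)) e4 (disjoint_left.2 fun e he h' => by
      simp only [mem_insert, mem_singleton] at h'
      rcases h' with rfl | rfl <;> contradiction) hcl with h1 | h1
  · obtain ⟨e, he⟩ := card_eq_one.1 (show E.card = 1 by have := e4.card_pos; omega)
    subst he
    have hout : ∀ w, adj e w → w = b ∨ w = s := by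
      intro w hw
      rcases hcl e (by simp) w hw with h' | h'
      · rw [mem_singleton] at h'; subst h'; exact absurd hw (h.irr _)
      · simpa using h'
    have := sub2 (h.dout e) (a := b) (b := s) (fun w hw => hout w (mem_outN.1 hw))
    simp only [mem_outN] at this
    exact ⟨e, rfl, this.1, this.2, g.J this.2, hout⟩
  · exfalso
    have := card_le_one.1 h1 x (by
      simp only [mem_compl, mem_union, mem_insert, mem_singleton]
      rintro ((h' | h') | h')
      exacts [h.ne hxb h', h.ne g.sx h'.symm, hxE h']) t (by
      simp only [mem_compl, mem_union, mem_insert, mem_singleton]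
      rintro ((h' | h') | h')
      exacts [hbt h'.symm, h.ne g.st h'.symm, ht h'])
    exact h.ne g.tx this.symm

theorem K2.exB (g : K2 adj x s t)
    (hcrit : ∀ b, adj b s → ¬ Str adj ((({x, s} : Finset V)ᶜ).erase b)) :
    ∃ b, adj b s ∧ adj t b ∧ ∀ w, adj t w → w = x ∨ w = b := by
  have h := g.h
  have hT := h.hT
  have hZ := g.strZ
  have hbZ : ∀ {b}, adj b s → b ∈ (({x, s} : Finset V)ᶜ) := fun hb => g.memZ.2 (.inr (g.J hb))
  have hex : ∃ m, ∃ b E, adj b s ∧ Trap adj (({x, s} : Finset V)ᶜ) b E ∧ t ∈ E ∧ E.card = m := by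
    by_contra hcon
    push Not at hcon
    refine claim1 h (J := inN adj s) (c := s) (q := x) ?_ ?_ ?_ ?_ (h.ne g.sx).symm
    · rw [mem_inN]; exact h.irr _
    · rw [← card_pos]; have := h.din s; omega
    · intro b hb
      rw [mem_inN] at hb
      obtain ⟨E, hE⟩ := trap_of_crit (hbZ hb) (hcrit b hb)
      obtain ⟨e, -, k2, k3, k4, k5⟩ := g.typeA hb hE (fun h' => hcon _ b E hb hE h' rfl)
      exact ⟨e, mem_inN.2 k3, k2, k5⟩
    · rw [mem_inN]; exact fun h' => h.asym h' g.sx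
  obtain ⟨b, E, hb, hE, htE, hEm⟩ := Nat.find_spec hex
  have hmin : ∀ b' E', adj b' s → Trap adj (({x, s} : Finset V)ᶜ) b' E' → t ∈ E' → E.card ≤ E'.card := by
    intro b' E' h1 h2 h3
    rw [hEm]
    exact Nat.find_min' hex ⟨b', E', h1, h2, h3, rfl⟩
  obtain ⟨e1, e2, e3, e4, ⟨q, q1, q2, q3⟩, e6⟩ := id hE
  have hsE : s ∉ E := fun h' => by have := e2 h'; simp at this
  have hxE : x ∉ E := fun h' => by have := e2 h'; simp at this
  have hno : ∀ e ∈ E, ¬ adj e s := by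
    by_contra hcon
    push Not at hcon
    obtain ⟨j, hj, hjs⟩ := hcon
    refine claim1 h (J := E.filter (fun e => adj e s)) (c := s) (q := x) ?_ ?_ ?_ ?_ (h.ne g.sx).symm
    · simp [hsE]
    · exact ⟨j, mem_filter.2 ⟨hj, hjs⟩⟩
    · intro b' hb'
      rw [mem_filter] at hb'
      obtain ⟨hb'E, hb's⟩ := hb'
      have hb't := g.Jt hb's
      obtain ⟨E', hE'⟩ := trap_of_crit (hbZ hb's) (hcrit b' hb's)
      by_cases htE' : t ∈ E'
      · exfalso
        have h3 := trap3 hT hZ hE hb'E hE' (by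
          intro h'; rw [h', mem_singleton] at htE; exact hb't htE.symm)
        have h4 := hmin b' _ hb's h3 (mem_inter.2 ⟨htE, htE'⟩)
        have h5 : E ∩ E' ⊂ E := by
          refine Finset.ssubset_iff_subset_ne.2 ⟨inter_subset_left, fun h' => ?_⟩
          rw [← h'] at hb'E
          exact hE'.2.2.1 (mem_inter.1 hb'E).2
        have := card_lt_card h5
        omega
      · obtain ⟨e, -, k2, k3, k4, k5⟩ := g.typeA hb's hE' htE'
        refine ⟨e, mem_filter.2 ⟨?_, k3⟩, k2, k5⟩
        by_contra heE
        by_cases heb : e = b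
        · subst heb
          refine hZ.closed (insert e E) ?_ e1 (mem_insert_self _ _) q1 (by simp [q2, q3])
          intro u hu huZ w hwZ huw
          rw [mem_insert] at hu ⊢
          rcases hu with rfl | hu
          · rcases k5 w huw with rfl | rfl
            · exact .inr hb'E
            · simp at hwZ
          · rcases e6 u hu w hwZ huw with h' | h'
            · exact .inr h'
            · exact .inl h'
        · have het : adj e t := by
            refine h.tot (g.Jt k3) fun h' => ?_
            rcases e6 t htE e (hbZ k3) h' with h'' | h'' <;> contradiction
          rcases k5 t het with h' | h'
          · exact hb't h'.symm
          · exact h.ne g.st h'.symm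
    · simp [hxE]
  have hxb := g.J hb
  have hcl : ∀ e ∈ E, ∀ w, adj e w → w ∈ E ∨ w ∈ ({x, b} : Finset V) := by
    intro e he w hw
    by_cases hwZ : w ∈ (({x, s} : Finset V)ᶜ)
    · rcases e6 e he w hwZ hw with h' | h'
      · exact .inl h'
      · right; simp [h']
    · simp only [mem_compl, mem_insert, mem_singleton, not_not] at hwZ
      rcases hwZ with rfl | rfl
      · right; simp
      · exact absurd hw (hno e he)
  have hqq : q ≠ s ∧ q ≠ x := by
    simp at q1; tauto
  rcases h.NT {x, b} E (card_pair (h.ne hxb)) e4 (disjoint_left.2 fun e he h' => by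
      simp only [mem_insert, mem_singleton] at h'
      rcases h' with rfl | rfl <;> contradiction) hcl with h1 | h1
  · have hEt : E = {t} := by
      obtain ⟨e, he⟩ := card_eq_one.1 (show E.card = 1 by have := e4.card_pos; omega)
      rw [he, mem_singleton] at htE; rw [he, htE]
    have hout : ∀ w, adj t w → w = x ∨ w = b := by
      intro w hw
      rcases hcl t htE w hw with h' | h'
      · rw [hEt, mem_singleton] at h'; subst h'; exact absurd hw (h.irr _)
      · simpa using h'
    have := sub2 (h.dout t) (a := x) (b := b) (fun w hw => hout w (mem_outN.1 hw))
    simp only [mem_outN] at this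
    exact ⟨b, hb, this.2, hout⟩
  · exfalso
    refine hqq.1 (card_le_one.1 h1 q ?_ s ?_)
    · simp only [mem_compl, mem_union, mem_insert, mem_singleton]; tauto
    · simp only [mem_compl, mem_union, mem_insert, mem_singleton]
      rintro ((h' | h') | h')
      exacts [h.ne g.sx h', h.ne hb h'.symm, hsE h']

theorem K2.fin1 (g : K2 adj x s t) {b o : V} (hb : adj b s)
    (htb : ∀ w, adj t w → w = x ∨ w = b) (hxo : adj x o) (hso : adj s o) (hob : adj o b)
    {L : ℕ} (hL : 3 ≤ L) (hLn : L + 3 ≤ Fintype.card V) : Good adj L := by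
  have h := g.h
  have hxb := g.J hb
  have hZ : Str adj (insert s (outN adj x)) :=
    str_insert g.hY (mem_outN.2 hxo) (mem_outN.2 hxb) hso hb
  have hd := h.deg x
  have hin : (inN adj x).card = 2 := by
    have : inN adj x = {s, t} := by ext w; rw [mem_inN, g.hx]; simp
    rw [this, card_pair (h.ne g.st)]
  have hcard : (insert s (outN adj x)).card + 2 = Fintype.card V := by
    rw [card_insert_of_notMem (by rw [mem_outN]; exact fun h' => h.asym h' g.sx)]; omega
  have hc3 : ({b, s, o} : Finset V).card = 3 :=
    card_eq_three.2 ⟨b, s, o, h.ne hb, (h.ne hob).symm, h.ne hso, rfl⟩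
  obtain ⟨B, b1, b2, b3, b4⟩ := grow_keep h.hT hZ (str_tri hb hso hob) (K := {b, s}) (by
      intro w; simp only [mem_insert, mem_singleton, mem_outN]
      rintro (rfl | rfl | rfl) <;> simp [*]) (by
      intro w; simp only [mem_insert, mem_singleton]; tauto) (by
      rw [hc3, card_pair (h.ne hb)]; omega) (by omega) L (by omega) (by omega)
  refine ⟨B, b4, b2, ?_⟩
  obtain ⟨y, hy, hyB⟩ : ∃ y ∈ insert s (outN adj x), y ∉ B := by
    by_contra hcon; push Not at hcon
    have := card_le_card (show insert s (outN adj x) ⊆ B from hcon); omega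
  have hsB : s ∈ B := b3 (by simp)
  have hbB : b ∈ B := b3 (by simp)
  have hyY : ∀ v, adj x v → v ∉ B → adj v t := by
    intro v hv hvB
    refine h.tot ?_ fun h' => ?_
    · rintro rfl; exact h.asym hv g.tx
    · rcases htb v h' with rfl | rfl
      · exact h.irr _ hv
      · contradiction
  have hxy : adj x y := by
    rw [mem_insert, mem_outN] at hy
    rcases hy with rfl | hy
    · contradiction
    · exact hy
  have hmB : ∀ v ∈ B, v = s ∨ adj x v := by
    intro v hv; have := b1 hv; rwa [mem_insert, mem_outN] at this
  refine str_xy (x := t) (y := x) (s := y) ?_ ?_ (mem_compl.2 hyB) g.tx hxy (hyY y hxy hyB) ?_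
  · rw [mem_compl]; intro h'
    rcases hmB _ h' with h'' | h''
    · exact h.ne g.st h''.symm
    · exact h.asym h'' g.tx
  · rw [mem_compl]; intro h'
    rcases hmB _ h' with h'' | h''
    · exact h.ne g.sx h''.symm
    · exact h.irr _ h''
  · intro v hv
    rcases g.all v with rfl | rfl | rfl | h'
    · simp
    · exact absurd hsB (mem_compl.1 hv)
    · simp
    · exact .inr (.inr (.inr ⟨h', hyY v h' (mem_compl.1 hv)⟩))

theorem K2.fin2 (g : K2 adj x s t)
    (hcrit : ∀ b, adj b s → ¬ Str adj ((({x, s} : Finset V)ᶜ).erase b))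
    {b0 o : V} (hb0 : adj b0 s) (htb0 : adj t b0)
    (htb : ∀ w, adj t w → w = x ∨ w = b0) (hxo : adj x o) (hso : adj s o)
    (hbo : ∀ o, adj x o → adj s o → adj b0 o) : False := by
  have h := g.h
  have hbZ : ∀ {b}, adj b s → b ∈ (({x, s} : Finset V)ᶜ) := fun hb => g.memZ.2 (.inr (g.J hb))
  have hxb0 := g.J hb0
  refine claim1 h.flip (J := (inN adj s).erase b0) (c := x) (q := s) ?_ ?_ ?_ ?_ (h.ne g.sx)
  · rw [mem_erase, mem_inN]; exact fun h' => h.asym h'.2 g.sx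
  · rw [← card_pos, card_erase_of_mem (mem_inN.2 hb0)]; have := h.din s; omega
  · intro b hb
    rw [mem_erase, mem_inN] at hb
    obtain ⟨hbb0, hbs⟩ := hb
    have hxb := g.J hbs
    have hbt := g.Jt hbs
    obtain ⟨E, hE⟩ := trap_of_crit (hbZ hbs) (hcrit b hbs)
    have htE : t ∈ E := by
      by_contra htE
      obtain ⟨e, -, k2, k3, k4, k5⟩ := g.typeA hbs hE htE
      by_cases heb : e = b0
      · subst heb
        rcases k5 o (hbo o hxo hso) with rfl | rfl
        · exact h.asym hso hbs
        · exact h.irr _ hso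
      · have het : adj e t := by
          refine h.tot (g.Jt k3) fun h' => ?_
          rcases htb e h' with rfl | rfl
          · exact h.irr _ k4
          · exact heb rfl
        rcases k5 t het with h' | h'
        · exact hbt h'.symm
        · exact h.ne g.st h'.symm
    obtain ⟨e1, e2, e3, e4, ⟨q, q1, q2, q3⟩, e6⟩ := id hE
    have hsE : s ∉ E := fun h' => by have := e2 h'; simp at this
    have hxE : x ∉ E := fun h' => by have := e2 h'; simp at this
    have hb0E : b0 ∈ E := by
      rcases e6 t htE b0 (hbZ hb0) htb0 with h' | h'
      · exact h'
      · exact absurd h'.symm hbb0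
    have hOE : ∀ w, adj x w → adj s w → w ∈ E := by
      intro w hw hsw
      rcases e6 b0 hb0E w (g.memZ.2 (.inr hw)) (hbo w hw hsw) with h' | h'
      · exact h'
      · subst h'; exact (h.asym hsw hbs).elim
    have hqs : q ≠ x ∧ q ≠ s := by simp at q1; tauto
    have hcl : ∀ e ∈ insert s E, ∀ w, adj e w → w ∈ insert s E ∨ w ∈ ({x, b} : Finset V) := by
      intro e he w hw
      rw [mem_insert] at he
      simp only [mem_insert, mem_singleton]
      rcases he with rfl | he
      · rcases g.all w with rfl | rfl | rfl | h'
        · simp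
        · simp
        · simp [htE]
        · exact .inl (.inr (hOE w h' hw))
      · by_cases hwZ : w ∈ (({x, s} : Finset V)ᶜ)
        · rcases e6 e he w hwZ hw with h' | h' <;> simp [h']
        · simp only [mem_compl, mem_insert, mem_singleton, not_not] at hwZ
          tauto
    have hqn : q ∉ insert s E ∧ q ∉ ({x, b} : Finset V) := by simp; tauto
    have hqc : q ∈ (({x, b} : Finset V) ∪ insert s E)ᶜ := by
      rw [mem_compl, mem_union]; tauto
    rcases h.NT {x, b} (insert s E) (card_pair (h.ne hxb)) ⟨s, by simp⟩
      (disjoint_left.2 fun e he h' => by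
        simp only [mem_insert, mem_singleton] at h' he
        have := h.ne g.sx
        have := h.ne hbs
        rcases h' with rfl | rfl
        · rcases he with h' | h'
          · exact h.ne g.sx h'.symm
          · contradiction
        · rcases he with h' | h'
          · contradiction
          · contradiction) hcl with h1 | h1
    · rw [card_insert_of_notMem hsE] at h1
      have := e4.card_pos; omega
    · have hin : ∀ w, adj w q → w = b ∨ w = x := by
        intro w hw
        by_cases hwR : w ∈ ({x, b} : Finset V)
        · simp at hwR; tauto
        by_cases hwE : w ∈ insert s E
        · have := hcl w hwE q hw; tauto
        · exact absurd (card_le_one.1 h1 w (by rw [mem_compl, mem_union]; tauto) q hqc) (h.ne hw)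
      have := sub2 (h.din q) (a := b) (b := x) (fun w hw => hin w (mem_inN.1 hw))
      simp only [mem_inN] at this
      refine ⟨q, ?_, this.1, hin⟩
      rw [mem_erase, mem_inN]
      refine ⟨?_, h.tot hqs.2 fun h' => q2 (hOE q this.2 h')⟩
      rintro rfl; contradiction
  · rw [mem_erase, mem_inN]; exact fun h' => h.irr _ h'.2

theorem K2.main (g : K2 adj x s t) {L : ℕ} (hL : 3 ≤ L) (hLn : L + 3 ≤ Fintype.card V) :
    Good adj L := by
  have h := g.h
  by_cases hO : ∀ w, adj x w → adj w s
  · exact g.caseO hO hL hLn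
  push Not at hO
  obtain ⟨o, hxo, hos⟩ := hO
  have hso : adj s o := h.tot (by rintro rfl; exact h.asym hxo g.sx) hos
  by_cases hcrit : ∀ b, adj b s → ¬ Str adj ((({x, s} : Finset V)ᶜ).erase b)
  · obtain ⟨b, hb, htb, hb'⟩ := g.exB hcrit
    by_cases ho : ∃ o, adj x o ∧ adj s o ∧ adj o b
    · obtain ⟨o, o1, o2, o3⟩ := ho
      exact g.fin1 hb hb' o1 o2 o3 hL hLn
    · push Not at ho
      refine (g.fin2 hcrit hb htb hb' hxo hso fun o h1 h2 => h.tot ?_ (ho o h1 h2)).elim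
      rintro rfl; exact h.asym hb h2
  · push Not at hcrit
    obtain ⟨b, hb, hB⟩ := hcrit
    exact c1_fin h g.sx g.hs (g.J hb) hb hB hL hLn

end TT
end

section
namespace TT
open Classical Finset
variable {adj : V → V → Prop}
set_option linter.unusedSectionVars false
variable [Fintype V]

def Quad (adj : V → V → Prop) : Prop :=
  ∃ a b c d, adj a b ∧ adj a c ∧ adj a d ∧ adj b c ∧ adj b d ∧ adj c d

theorem FA {k : ℕ} (h : Ctx adj k) {x : V} (hx : (inN adj x).card = k)
    {L : ℕ} (hL : 3 ≤ L) (hLn : 2 * L ≤ Fintype.card V) (hexc : Fintype.card V = 7 → Quad adj) :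
    Good adj L ∨ (k = 4 ∧ (¬ ∀ v, adj v x → ∃ w, adj w x ∧ adj v w) ∧
      ∃ z, (inN adj z).card = 4 ∧ ∀ v, adj v z → ∃ w, adj w z ∧ adj v w) := by
  by_cases hY : Str adj (outN adj x)
  swap
  · exact .inl (case_II h hx hY hL hLn)
  have hk := h.hk
  obtain ⟨C, c1, c2, c3, c4⟩ := init_comp h.hT (inN adj x) (by rw [← card_pos]; omega)
  have hc2 := str_card_ne_two h.hT c3
  rcases Nat.lt_or_ge C.card 3 with hC | hC
  · left
    obtain ⟨s, rfl⟩ := card_eq_one.1 (show C.card = 1 by have := c2.card_pos; omega)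
    have hsx : adj s x := mem_inN.1 (c1 (by simp))
    have hs : ∀ w, adj w x → w ≠ s → adj s w := fun w hw hws =>
      c4 s (by simp) w (mem_inN.2 hw) (by simpa using hws)
    have hL3 : L + 3 ≤ Fintype.card V := by omega
    rcases Nat.lt_or_ge k 4 with hk4 | hk4
    · rcases Nat.lt_or_ge k 3 with hk3 | hk3
      · have : k = 2 := by omega
        subst this
        have h1 : ((inN adj x).erase s).card = 1 := by
          rw [card_erase_of_mem (mem_inN.2 hsx)]; omega
        obtain ⟨t, ht⟩ := card_eq_one.1 h1
        have hxx : ∀ w, adj w x ↔ w = s ∨ w = t := by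
          intro w
          have h2 : w ∈ (inN adj x).erase s ↔ w = t := by rw [ht]; simp
          rw [mem_erase, mem_inN] at h2
          constructor
          · intro hw; by_cases hws : w = s
            · exact .inl hws
            · exact .inr (h2.1 ⟨hws, hw⟩)
          · rintro (rfl | hw)
            · exact hsx
            · exact (h2.2 hw).2
        have htm : t ∈ (inN adj x).erase s := by rw [ht]; simp
        rw [mem_erase, mem_inN] at htm
        exact K2.main ⟨h, hxx, hs t htm.2 htm.1, hY⟩ hL hL3
      · have : k = 3 := by omega
        subst this
        exact c1_k3 h hsx hs hL hL3
    · exact c1_k4 h hk4 hsx hs hL hL3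
  · exact caseI_C3 h hx hY c1 c3 c4 hC hL hLn hexc

theorem FF {k : ℕ} (h : Ctx adj k) {x : V} (hx : (inN adj x).card = k)
    {L : ℕ} (hL : 3 ≤ L) (hLn : 2 * L ≤ Fintype.card V) (hexc : Fintype.card V = 7 → Quad adj) :
    Good adj L := by
  rcases FA h hx hL hLn hexc with h' | ⟨rfl, -, z, hz, hz'⟩
  · exact h'
  rcases FA h hz hL hLn hexc with h' | ⟨-, hc, -⟩
  · exact h'
  · exact absurd hz' hc

theorem dout0 (hT : IsTournament adj) {k : ℕ} (hn : k + 1 ≤ Fintype.card V)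
    (K : ∀ R : Finset V, R.card < k → Str adj Rᶜ) (v : V) : k ≤ (outN adj v).card := by
  by_contra hc
  have hs := K (outN adj v) (by omega)
  obtain ⟨w, hw, hw'⟩ := hs.out (v := v) (by rw [mem_compl, mem_outN]; exact hT.1 v)
    (by rw [card_compl]; omega)
  exact mem_compl.1 hw (mem_outN.2 hw')

theorem deg0 (hT : IsTournament adj) {k : ℕ} (hn : k + 1 ≤ Fintype.card V)
    (K : ∀ R : Finset V, R.card < k → Str adj Rᶜ) (v : V) : 2 * k + 1 ≤ Fintype.card V := by
  have h1 := dout0 hT hn K v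
  have h2 := dout0 (flipT hT) hn (fun R hR => (K R hR).flip) v
  have hd : Disjoint (outN adj v) (outN (flip adj) v) := by
    rw [disjoint_left]; intro w; rw [mem_outN, mem_outN]; exact hT.2.1 v w
  have hv : v ∉ outN adj v ∪ outN (flip adj) v := by
    rw [mem_union, mem_outN, mem_outN]; exact fun h => h.elim (hT.1 v) (hT.1 v)
  have h3 := card_le_univ (insert v (outN adj v ∪ outN (flip adj) v))
  rw [card_insert_of_notMem hv, card_union_of_disjoint hd] at h3
  omega

theorem main_good (hT : IsTournament adj) (hn : 6 ≤ Fintype.card V)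
    (K0 : ∀ R : Finset V, R.card < 2 → Str adj Rᶜ) {L : ℕ} (hL : 3 ≤ L)
    (hLn : 2 * L ≤ Fintype.card V) (hexc : Fintype.card V = 7 → Quad adj) : Good adj L := by
  have hex : ∃ k, ∃ R : Finset V, R.card = k ∧ ¬ Str adj Rᶜ := by
    obtain ⟨P, -, hP⟩ := exists_subset_card_eq (s := (univ : Finset V)) (n := 2) (by rw [card_univ]; omega)
    refine ⟨_, Pᶜ, rfl, ?_⟩
    rw [compl_compl]
    exact fun h => str_card_ne_two hT h hP
  obtain ⟨R, hR, hRs⟩ := Nat.find_spec hex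
  have K : ∀ R : Finset V, R.card < Nat.find hex → Str adj Rᶜ := by
    intro R hR
    have := Nat.find_min hex hR
    by_contra hc; exact this ⟨R, rfl, hc⟩
  have hk : 2 ≤ Nat.find hex := by
    by_contra hc; exact hRs (K0 R (by omega))
  generalize Nat.find hex = k at hR K hk
  obtain ⟨E, e1, e2, ⟨q, q1, q2⟩, e4⟩ := not_str hRs
  have hk1 : k + 1 ≤ Fintype.card V := by
    have : R.card < Fintype.card V := by
      rw [← card_univ]; apply card_lt_card
      rw [ssubset_univ_iff]; rintro rfl; simp at q1
    omega
  have hdeg := deg0 hT hk1 K q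
  by_cases NT : ∀ R E : Finset V, R.card = k → E.Nonempty → Disjoint E R →
    (∀ e ∈ E, ∀ w, adj e w → w ∈ E ∨ w ∈ R) → E.card ≤ 1 ∨ ((R ∪ E)ᶜ).card ≤ 1
  · have h : Ctx adj k := ⟨hT, hk, hk1, K, NT⟩
    have hER : ∀ e ∈ E, e ∉ R := fun e he => mem_compl.1 (e1 he)
    have hcl : ∀ e ∈ E, ∀ w, adj e w → w ∈ E ∨ w ∈ R := by
      intro e he w hw
      by_cases hwR : w ∈ R
      · exact .inr hwR
      · exact .inl (e4 e he w (mem_compl.2 hwR) hw)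
    rcases NT R E hR e2 (disjoint_left.2 hER) hcl with h1 | h1
    · obtain ⟨z, rfl⟩ := card_eq_one.1 (show E.card = 1 by have := e2.card_pos; omega)
      have hsub : outN adj z ⊆ R := by
        intro w hw
        rw [mem_outN] at hw
        rcases hcl z (by simp) w hw with h' | h'
        · rw [mem_singleton] at h'; subst h'; exact absurd hw (hT.1 _)
        · exact h'
      have h2 := card_le_card hsub
      have h3 := h.dout z
      have h4 : (outN adj z).card = k := by omega
      refine (FF h.flip (x := z) h4 hL hLn ?_).flip
      intro h7
      obtain ⟨a, b, c, d, k1, k2, k3, k4, k5, k6⟩ := hexc h7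
      exact ⟨d, c, b, a, k6, k5, k3, k4, k2, k1⟩
    · have hqm : q ∈ (R ∪ E)ᶜ := by
        rw [mem_compl, mem_union, not_or]; exact ⟨mem_compl.1 q1, q2⟩
      have hsub : inN adj q ⊆ R := by
        intro w hw
        rw [mem_inN] at hw
        by_cases hwE : w ∈ E
        · exact absurd (hcl w hwE q hw) (by rw [not_or]; exact ⟨q2, mem_compl.1 q1⟩)
        by_contra hwR
        exact absurd (card_le_one.1 h1 w (by
            rw [mem_compl, mem_union, not_or]; exact ⟨hwR, hwE⟩) q hqm) (h.ne hw)
      have h2 := card_le_card hsub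
      have h3 := h.din q
      exact FF h (x := q) (by omega) hL hLn hexc
  · push Not at NT
    obtain ⟨R, E, r1, r2, r3, r4, r5, r6⟩ := NT
    refine nt_fail hT hk K (R := R) (P := (R ∪ E)ᶜ) (Q := E) r1 ?_ r3.symm ?_ ?_ ?_ (by omega) (by omega)
      hL (by omega)
    · rw [disjoint_left]; intro a ha; simp [ha]
    · rw [disjoint_left]; intro a ha; simp at ha; exact ha.2
    · ext a; simp; tauto
    · intro p hp q hq
      simp only [mem_compl, mem_union, not_or] at hp
      have hne : p ≠ q := by rintro rfl; exact hp.2 hq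
      rcases hT.2.2 p q hne with h' | h'
      · exact h'
      · rcases r4 q hq p h' with h'' | h''
        · exact absurd h'' hp.2
        · exact absurd h'' hp.1

theorem final (hT : IsTournament adj)
    (hn : 6 ≤ Fintype.card V) (L : ℕ) (hL3 : 3 ≤ L) (hLn : L ≤ Fintype.card V - 3)
    (hconn : StrKConnOn adj 2 Set.univ)
    (hexc : ¬ (Fintype.card V = 7 ∧ ∀ A : Set V, A.ncard = 4 → ¬ IsTransSet adj A)) :
    ∃ C₁ C₂ : List V,
      IsCycleList adj C₁ ∧ IsCycleList adj C₂ ∧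
      C₁.length = L ∧ C₂.length = Fintype.card V - L ∧
      ∀ v ∈ C₁, v ∉ C₂ := by
  have K0 : ∀ R : Finset V, R.card < 2 → Str adj Rᶜ := by
    intro R hR
    apply str_of_conn
    have := hconn.2 (R : Set V) (Set.subset_univ _) (by rwa [Set.ncard_coe_finset])
    rwa [coe_compl, Set.compl_eq_univ_sdiff]
  have hq : Fintype.card V = 7 → Quad adj := by
    intro h7
    by_contra hQ
    refine hexc ⟨h7, ?_⟩
    rintro A hA ⟨l, l1, l2, l3⟩
    have hAl : A = (l.toFinset : Set V) := by ext w; simp [l2]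
    have hl : l.length = 4 := by
      rw [← hA, hAl, Set.ncard_coe_finset, List.toFinset_card_of_nodup l1]
    refine hQ ⟨l.get ⟨0, by omega⟩, l.get ⟨1, by omega⟩, l.get ⟨2, by omega⟩, l.get ⟨3, by omega⟩,
      ?_, ?_, ?_, ?_, ?_, ?_⟩ <;> rw [l3] <;> simp
  have hG : Good adj L := by
    by_cases h2 : 2 * L ≤ Fintype.card V
    · exact main_good hT hn K0 hL3 h2 hq
    · exact good_symm (main_good hT hn K0 (L := Fintype.card V - L) (by omega) (by omega) hq) (by omega)
  obtain ⟨A, a1, a2, a3⟩ := hG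
  obtain ⟨p, p1, p2⟩ := camion hT a2 (by omega)
  obtain ⟨r, r1, r2⟩ := camion hT a3 (by rw [card_compl]; omega)
  refine ⟨p, r, p1, r1, ?_, ?_, ?_⟩
  · rw [← List.toFinset_card_of_nodup p1.2.1, p2, a1]
  · rw [← List.toFinset_card_of_nodup r1.2.1, r2, card_compl, a1]
  · intro v hv hv'
    rw [← List.mem_toFinset, p2] at hv
    rw [← List.mem_toFinset, r2, mem_compl] at hv'
    contradiction

end TT
end

/-- Every strongly 2-connected tournament on `n ≥ 6` vertices that is not
isomorphic to the unique tournament on 7 vertices containing no transitive subtournament on 4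
vertices (i.e. such that it is not the case that `n = 7` and no 4 vertices induce a transitive
subtournament) contains two vertex-disjoint directed cycles of lengths `L` and `n - L`,
for any `3 ≤ L ≤ n - 3`. -/
theorem stmt10 [Fintype V] (adj : V → V → Prop) (hT : IsTournament adj)
    (hn : 6 ≤ Fintype.card V) (L : ℕ) (hL3 : 3 ≤ L) (hLn : L ≤ Fintype.card V - 3)
    (hconn : StrKConnOn adj 2 Set.univ)
    (hexc : ¬ (Fintype.card V = 7 ∧ ∀ A : Set V, A.ncard = 4 → ¬ IsTransSet adj A)) :
    ∃ C₁ C₂ : List V,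
      IsCycleList adj C₁ ∧ IsCycleList adj C₂ ∧
      C₁.length = L ∧ C₂.length = Fintype.card V - L ∧
      ∀ v ∈ C₁, v ∉ C₂ := by
  exact TT.final hT hn L hL3 hLn hconn hexc
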